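/- Let H be a fixed graph and assume n is even. Then Pr[G(H,n,p) has a perfect matching] → 0 as n → ∞ if p ≤ p_1^-(H), and Pr[G(H,n,p) has a perfect matching] → 1 as n → ∞ if p ≥ p_1^+(H). -/

import Mathlib

open Filter

namespace RandomMotif

/-- `G` is a *copy* of `H` in the complete graph on `Fin n`: the image of `H`
under an injection of its vertices into `Fin n`. -/
def IsCopy {k n : ℕ} (H : SimpleGraph (Fin k)) (G : SimpleGraph (Fin n)) : Prop :=
  ∃ f : Fin k ↪ Fin n, G = H.map f

/-- The type of copies of `H` in `K_n`. -/
abbrev Copy {k : ℕ} (H : SimpleGraph (Fin k)) (n : ℕ) : Type :=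
  {G : SimpleGraph (Fin n) // IsCopy H G}

/-- The graph spanned by the selected copies. -/
noncomputable def graphOf {k n : ℕ} {H : SimpleGraph (Fin k)} (ω : Copy H n → Bool) :
    SimpleGraph (Fin n) :=
  ⨆ c : Copy H n, if ω c then c.1 else ⊥

open Classical in
/-- The probability, in the binomial random motif model `G(H,n,p)` (each copy of `H`
in `K_n` is included independently with probability `p`), of the event `P` on the
family of selected copies. -/
noncomputable def selProb {k : ℕ} (H : SimpleGraph (Fin k)) (n : ℕ) (p : ℝ)
    (P : (Copy H n → Bool) → Prop) : ℝ :=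
  ∑ ω : Copy H n → Bool,
    (∏ c : Copy H n, if ω c then p else 1 - p) * (if P ω then 1 else 0)

/-- The probability that `G(H,n,p)` satisfies the graph predicate `Q`. -/
noncomputable def motifProb {k : ℕ} (H : SimpleGraph (Fin k)) (n : ℕ) (p : ℝ)
    (Q : SimpleGraph (Fin n) → Prop) : ℝ :=
  selProb H n p (fun ω => Q (graphOf ω))

/-- `mr H n r` is the number of copies of `H` in `K_n` whose vertex set meets
`[r] = {0,…,r-1}`. -/
noncomputable def mr {k : ℕ} (H : SimpleGraph (Fin k)) (n r : ℕ) : ℕ :=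
  Nat.card {G : SimpleGraph (Fin n) // IsCopy H G ∧ ∃ v ∈ G.support, (v : ℕ) < r}

/-- The minimum degree `δ(H)`. -/
noncomputable def minDeg {k : ℕ} (H : SimpleGraph (Fin k)) : ℕ :=
  ⨅ v, (H.neighborSet v).ncard

/-- `δ_d(H) = ⌈d / δ(H)⌉ - 1`. -/
noncomputable def deltad {k : ℕ} (H : SimpleGraph (Fin k)) (d : ℕ) : ℕ :=
  ⌈(d : ℝ) / (minDeg H : ℝ)⌉₊ - 1

/-- `p_d^-(H) = (ln n + δ_d(H) ln ln n - x(n)) / m_1(H)`, where `x` is a fixed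
function with `1 ≪ x(n) ≪ ln ln n`. -/
noncomputable def pMinus {k : ℕ} (H : SimpleGraph (Fin k)) (d : ℕ) (x : ℕ → ℝ) (n : ℕ) : ℝ :=
  (Real.log n + (deltad H d) * Real.log (Real.log n) - x n) / (mr H n 1)

/-- `p_d^+(H) = (ln n + δ_d(H) ln ln n + x(n)) / m_1(H)`, where `x` is a fixed
function with `1 ≪ x(n) ≪ ln ln n`. -/
noncomputable def pPlus {k : ℕ} (H : SimpleGraph (Fin k)) (d : ℕ) (x : ℕ → ℝ) (n : ℕ) : ℝ :=
  (Real.log n + (deltad H d) * Real.log (Real.log n) + x n) / (mr H n 1)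

section Bernoulli

variable {α : Type*} [Fintype α]

/-- The weight of a configuration under the product Bernoulli measure. -/
noncomputable def bern (p : ℝ) (ω : α → Bool) : ℝ :=
  ∏ c : α, if ω c then p else 1 - p

lemma bern_nonneg {p : ℝ} (h0 : 0 ≤ p) (h1 : p ≤ 1) (ω : α → Bool) : 0 ≤ bern p ω := by
  refine Finset.prod_nonneg fun c _ => ?_
  split_ifs <;> linarith

lemma bern_mul_bern_le {p q : ℝ} (h0 : 0 ≤ p) (hpq : p ≤ q) (h1 : q ≤ 1) (a b : α → Bool) :
    bern p a * bern q b ≤ bern p (a ⊓ b) * bern q (a ⊔ b) := by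
  simp only [bern, ← Finset.prod_mul_distrib]
  refine Finset.prod_le_prod (fun c _ => ?_) fun c _ => ?_
  · apply mul_nonneg <;> split_ifs <;> linarith
  · cases ha : a c <;> cases hb : b c <;> (simp [ha, hb]; try nlinarith)

variable [DecidableEq α]

open Classical in
/-- The probability of an event under the product Bernoulli measure. -/
noncomputable def prob (p : ℝ) (P : (α → Bool) → Prop) : ℝ :=
  ∑ ω : α → Bool, bern p ω * (if P ω then 1 else 0)

lemma sum_bern_mul_prod (p : ℝ) (g : α → Bool → ℝ) :
    ∑ ω : α → Bool, bern p ω * ∏ c, g c (ω c) = ∏ c, (p * g c true + (1 - p) * g c false) := by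
  have := Finset.prod_univ_sum (fun _ : α => (Finset.univ : Finset Bool))
    (fun c b => (if b then p else 1 - p) * g c b)
  simp only [Fintype.piFinset_univ, Fintype.sum_bool] at this
  simpa [bern, ← Finset.prod_mul_distrib] using this.symm

lemma sum_bern (p : ℝ) : ∑ ω : α → Bool, bern p ω = 1 := by
  simpa using sum_bern_mul_prod (α := α) p (fun _ _ => 1)

lemma prob_nonneg {p : ℝ} (h0 : 0 ≤ p) (h1 : p ≤ 1) (P : (α → Bool) → Prop) : 0 ≤ prob p P := by
  classical
  refine Finset.sum_nonneg fun ω _ => mul_nonneg (bern_nonneg h0 h1 ω) ?_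
  split_ifs <;> norm_num

lemma prob_mono {p : ℝ} (h0 : 0 ≤ p) (h1 : p ≤ 1) {P Q : (α → Bool) → Prop}
    (h : ∀ ω, P ω → Q ω) : prob p P ≤ prob p Q := by
  classical
  refine Finset.sum_le_sum fun ω _ => mul_le_mul_of_nonneg_left ?_ (bern_nonneg h0 h1 ω)
  by_cases hP : P ω
  · simp [hP, h ω hP]
  · simp only [hP, if_false]
    split_ifs <;> norm_num

lemma prob_true (p : ℝ) : prob p (fun _ : α → Bool => True) = 1 := by
  simp [prob, sum_bern]

lemma prob_le_one {p : ℝ} (h0 : 0 ≤ p) (h1 : p ≤ 1) (P : (α → Bool) → Prop) : prob p P ≤ 1 := by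
  rw [← prob_true (α := α) p]
  exact prob_mono h0 h1 fun _ _ => trivial

lemma prob_not (p : ℝ) (P : (α → Bool) → Prop) : prob p (fun ω => ¬ P ω) = 1 - prob p P := by
  classical
  rw [← prob_true (α := α) p, prob, prob, prob, ← Finset.sum_sub_distrib]
  refine Finset.sum_congr rfl fun ω _ => ?_
  by_cases h : P ω <;> simp [h]

lemma prob_exists_le {p : ℝ} (h0 : 0 ≤ p) (h1 : p ≤ 1) {ι : Type*} (s : Finset ι)
    (P : ι → (α → Bool) → Prop) :
    prob p (fun ω => ∃ i ∈ s, P i ω) ≤ ∑ i ∈ s, prob p (P i) := by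
  classical
  simp only [prob]
  rw [Finset.sum_comm]
  refine Finset.sum_le_sum fun ω _ => ?_
  rw [← Finset.mul_sum]
  refine mul_le_mul_of_nonneg_left ?_ (bern_nonneg h0 h1 ω)
  split_ifs with h
  · obtain ⟨i, hi, hP⟩ := h
    calc (1 : ℝ) = if P i ω then 1 else 0 := by simp [hP]
      _ ≤ _ := Finset.single_le_sum (f := fun i => if P i ω then (1 : ℝ) else 0)
        (fun j _ => by positivity) hi
  · exact Finset.sum_nonneg fun i _ => by positivity

open Classical in
lemma sum_prob_le {p : ℝ} (h0 : 0 ≤ p) (h1 : p ≤ 1) {ι : Type*} (s : Finset ι)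
    (P : ι → (α → Bool) → Prop) (E : (α → Bool) → Prop) {a : ℝ} (ha : 0 ≤ a)
    (hE : ∀ ω, ¬ E ω → ((s.filter fun i => P i ω).card : ℝ) ≤ a) :
    ∑ i ∈ s, prob p (P i) ≤ a + s.card * prob p E := by
  have e1 : ∑ i ∈ s, prob p (P i) =
      ∑ ω : α → Bool, bern p ω * ((s.filter fun i => P i ω).card : ℝ) := by
    simp only [prob]
    rw [Finset.sum_comm]
    refine Finset.sum_congr rfl fun ω _ => ?_
    rw [← Finset.mul_sum, Finset.sum_boole]
  have e2 : a = ∑ ω : α → Bool, bern p ω * a := by rw [← Finset.sum_mul, sum_bern, one_mul]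
  rw [e1, prob, Finset.mul_sum]
  nth_rw 1 [e2]
  rw [← Finset.sum_add_distrib]
  refine Finset.sum_le_sum fun ω _ => ?_
  rw [mul_left_comm, ← mul_add]
  refine mul_le_mul_of_nonneg_left ?_ (bern_nonneg h0 h1 ω)
  by_cases h : E ω
  · have : ((s.filter fun i => P i ω).card : ℝ) ≤ s.card := by
      exact_mod_cast Finset.card_filter_le _ _
    simp only [h, if_true]
    linarith
  · simpa [h] using hE ω h

lemma prob_or_le {p : ℝ} (h0 : 0 ≤ p) (h1 : p ≤ 1) (P Q : (α → Bool) → Prop) :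
    prob p (fun ω => P ω ∨ Q ω) ≤ prob p P + prob p Q := by
  classical
  simp only [prob]
  rw [← Finset.sum_add_distrib]
  refine Finset.sum_le_sum fun ω _ => ?_
  rw [← mul_add]
  refine mul_le_mul_of_nonneg_left ?_ (bern_nonneg h0 h1 ω)
  by_cases hP : P ω <;> by_cases hQ : Q ω <;> simp [hP, hQ]

lemma prob_cylinder (p : ℝ) {T F : Finset α} (h : Disjoint T F) :
    prob p (fun ω => (∀ c ∈ T, ω c = true) ∧ ∀ c ∈ F, ω c = false) =
      p ^ T.card * (1 - p) ^ F.card := by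
  classical
  have h1 := sum_bern_mul_prod (α := α) p
    (fun c b => (if c ∈ T then (if b then 1 else 0) else 1) *
      (if c ∈ F then (if b then 0 else 1) else 1))
  have h2 : ∀ ω : α → Bool, (∏ c, (if c ∈ T then (if ω c then (1 : ℝ) else 0) else 1) *
      (if c ∈ F then (if ω c then 0 else 1) else 1)) =
      if (∀ c ∈ T, ω c = true) ∧ ∀ c ∈ F, ω c = false then 1 else 0 := by
    intro ω
    split_ifs with hc
    · refine Finset.prod_eq_one fun c _ => ?_
      have hd : c ∈ T → c ∉ F := fun h' => Finset.disjoint_left.mp h h'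
      by_cases hT : c ∈ T <;> by_cases hF : c ∈ F <;> simp_all
    · rw [Finset.prod_eq_zero_iff]
      rw [not_and_or] at hc
      rcases hc with hc | hc <;> push Not at hc <;> obtain ⟨c, hc, hc'⟩ := hc <;>
        refine ⟨c, Finset.mem_univ _, ?_⟩ <;> simp_all
  rw [Finset.sum_congr rfl fun ω _ => by rw [h2 ω]] at h1
  have h4 : prob p (fun ω => (∀ c ∈ T, ω c = true) ∧ ∀ c ∈ F, ω c = false) =
      ∑ ω, bern p ω * if (∀ c ∈ T, ω c = true) ∧ ∀ c ∈ F, ω c = false then 1 else 0 := by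
    rw [prob]
    refine Finset.sum_congr rfl fun ω _ => ?_
    congr
  rw [h4, h1]
  have h3 : ∀ c, p * ((if c ∈ T then (if true = true then (1 : ℝ) else 0) else 1) *
      (if c ∈ F then (if true = true then 0 else 1) else 1)) +
      (1 - p) * ((if c ∈ T then (if false = true then (1 : ℝ) else 0) else 1) *
      (if c ∈ F then (if false = true then 0 else 1) else 1)) =
      (if c ∈ T then p else 1) * (if c ∈ F then 1 - p else 1) := by
    intro c
    have hd : c ∈ T → c ∉ F := fun h' => Finset.disjoint_left.mp h h'
    by_cases hT : c ∈ T <;> by_cases hF : c ∈ F <;> simp_all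
  rw [Finset.prod_congr rfl fun c _ => h3 c, Finset.prod_mul_distrib]
  simp [Finset.prod_ite_mem, Finset.prod_const]

lemma prob_none (p : ℝ) (F : Finset α) :
    prob p (fun ω => ∀ c ∈ F, ω c = false) = (1 - p) ^ F.card := by
  simpa using prob_cylinder p (Finset.disjoint_empty_left F)

lemma prob_none_le {p : ℝ} (h1 : p ≤ 1) (F : Finset α) :
    prob p (fun ω => ∀ c ∈ F, ω c = false) ≤ Real.exp (-(p * F.card)) := by
  rw [prob_none]
  calc (1 - p) ^ F.card ≤ (Real.exp (-p)) ^ F.card :=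
        pow_le_pow_left₀ (by linarith) (Real.one_sub_le_exp_neg p) _
    _ = _ := by rw [← Real.exp_nat_mul]; ring_nf

/-- Selecting at least `t` members of a fixed family is unlikely. -/
lemma prob_many_le {p : ℝ} (h0 : 0 ≤ p) (h1 : p ≤ 1) (S : Finset α) (t : ℕ) {x : ℝ}
    (hx : S.card * p ≤ x) :
    prob p (fun ω => t ≤ (S.filter (fun c => ω c = true)).card) ≤ (Real.exp 1 * x / t) ^ t := by
  classical
  have hx0 : 0 ≤ x := le_trans (by positivity) hx
  rcases Nat.eq_zero_or_pos t with rfl | ht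
  · simpa using prob_le_one h0 h1 _
  calc _ ≤ prob p (fun ω => ∃ T ∈ S.powersetCard t, ∀ c ∈ T, ω c = true) := by
        refine prob_mono h0 h1 fun ω h => ?_
        obtain ⟨T, hT, hc⟩ := Finset.exists_subset_card_eq h
        exact ⟨T, Finset.mem_powersetCard.mpr ⟨hT.trans (Finset.filter_subset _ _), hc⟩,
          fun c hc => (Finset.mem_filter.mp (hT hc)).2⟩
    _ ≤ ∑ T ∈ S.powersetCard t, prob p (fun ω => ∀ c ∈ T, ω c = true) :=
        prob_exists_le h0 h1 _ _
    _ = ∑ T ∈ S.powersetCard t, p ^ t := by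
        refine Finset.sum_congr rfl fun T hT => ?_
        have := prob_cylinder p (Finset.disjoint_empty_right T)
        simpa [(Finset.mem_powersetCard.mp hT).2] using this
    _ = S.card.choose t * p ^ t := by simp
    _ ≤ (S.card ^ t / t.factorial) * p ^ t := by
        gcongr
        exact Nat.choose_le_pow_div _ _
    _ = (S.card * p) ^ t / t.factorial := by rw [mul_pow]; ring
    _ ≤ x ^ t / t.factorial := by gcongr
    _ ≤ _ := by
        have h2 := Real.pow_div_factorial_le_exp (x := (t : ℝ)) (by positivity) t
        rw [div_le_iff₀ (by positivity)] at h2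
        have h3 : Real.exp t = Real.exp 1 ^ t := by rw [← Real.exp_nat_mul]; simp
        rw [h3] at h2
        rw [div_pow, mul_pow, div_le_div_iff₀ (by positivity) (by positivity)]
        calc x ^ t * (t : ℝ) ^ t ≤ x ^ t * (Real.exp 1 ^ t * t.factorial) := by gcongr
          _ = _ := by ring

/-- Selecting fewer than `t` members of a fixed family is unlikely. -/
lemma prob_few_le {p : ℝ} (h0 : 0 ≤ p) (h1 : p ≤ 1) (S : Finset α) (t : ℕ) {x : ℝ}
    (hx : S.card * p ≤ x) (hx1 : 1 ≤ x) :
    prob p (fun ω => (S.filter (fun c => ω c = true)).card < t) ≤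
      t * (x ^ t * Real.exp t * Real.exp (-(p * S.card))) := by
  classical
  calc _ ≤ prob p (fun ω => ∃ j ∈ Finset.range t, ∃ T ∈ S.powersetCard j,
          (∀ c ∈ T, ω c = true) ∧ ∀ c ∈ S \ T, ω c = false) := by
        refine prob_mono h0 h1 fun ω h => ?_
        refine ⟨_, Finset.mem_range.mpr h, S.filter (fun c => ω c = true),
          Finset.mem_powersetCard.mpr ⟨Finset.filter_subset _ _, rfl⟩,
          fun c hc => (Finset.mem_filter.mp hc).2, fun c hc => ?_⟩
        simp only [Finset.mem_sdiff, Finset.mem_filter, not_and, Bool.not_eq_true] at hc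
        exact hc.2 hc.1
    _ ≤ ∑ j ∈ Finset.range t, ∑ T ∈ S.powersetCard j, prob p (fun ω =>
          (∀ c ∈ T, ω c = true) ∧ ∀ c ∈ S \ T, ω c = false) :=
        (prob_exists_le h0 h1 _ _).trans
          (Finset.sum_le_sum fun j _ => prob_exists_le h0 h1 _ _)
    _ ≤ ∑ j ∈ Finset.range t, x ^ t * Real.exp t * Real.exp (-(p * S.card)) := by
        refine Finset.sum_le_sum fun j hj => ?_
        have hjt : j ≤ t := (Finset.mem_range.mp hj).le
        calc _ ≤ ∑ T ∈ S.powersetCard j, p ^ j * (Real.exp t * Real.exp (-(p * S.card))) := by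
              refine Finset.sum_le_sum fun T hT => ?_
              obtain ⟨hTS, hTc⟩ := Finset.mem_powersetCard.mp hT
              rw [prob_cylinder p Finset.disjoint_sdiff, hTc, Finset.card_sdiff_of_subset hTS, hTc]
              refine mul_le_mul_of_nonneg_left ?_ (by positivity)
              have hjS : j ≤ S.card := hTc ▸ Finset.card_le_card hTS
              calc (1 - p) ^ (S.card - j) ≤ (Real.exp (-p)) ^ (S.card - j) :=
                    pow_le_pow_left₀ (by linarith) (Real.one_sub_le_exp_neg p) _
                _ = Real.exp (p * j - p * S.card) := by
                    rw [← Real.exp_nat_mul, Nat.cast_sub hjS]; ring_nf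
                _ ≤ Real.exp (t + -(p * S.card)) := by
                    refine Real.exp_le_exp.mpr ?_
                    have : (j : ℝ) ≤ t := by exact_mod_cast hjt
                    have : p * j ≤ 1 * t := by gcongr
                    linarith
                _ = _ := Real.exp_add _ _
          _ = S.card.choose j * p ^ j * (Real.exp t * Real.exp (-(p * S.card))) := by
              simp; ring
          _ ≤ x ^ t * (Real.exp t * Real.exp (-(p * S.card))) := by
              gcongr
              calc (S.card.choose j : ℝ) * p ^ j ≤ (S.card : ℝ) ^ j * p ^ j := by
                    gcongr; exact_mod_cast Nat.choose_le_pow _ _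
                _ = (S.card * p) ^ j := by rw [mul_pow]
                _ ≤ x ^ j := by gcongr
                _ ≤ x ^ t := pow_le_pow_right₀ hx1 hjt
          _ = _ := by ring
    _ = _ := by simp

/-- The probability of an increasing event is monotone in `p`. -/
lemma prob_mono_param {p q : ℝ} (h0 : 0 ≤ p) (hpq : p ≤ q) (h1 : q ≤ 1)
    {P : (α → Bool) → Prop} (hP : ∀ a b, a ≤ b → P a → P b) : prob p P ≤ prob q P := by
  classical
  have := holley (bern p) (bern q) (fun ω : α → Bool => if P ω then (1 : ℝ) else 0)
    (fun ω => by dsimp; positivity) (fun ω => bern_nonneg h0 (hpq.trans h1) ω)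
    (fun ω => bern_nonneg (h0.trans hpq) h1 ω)
    (fun a b hab => by
      dsimp
      by_cases h : P a
      · simp [h, hP a b hab h]
      · simp only [h, if_false]; positivity)
    (by rw [sum_bern, sum_bern]) (bern_mul_bern_le h0 hpq h1)
  simpa only [prob, mul_comm] using this

/-- Decreasing and increasing events are negatively correlated. -/
lemma prob_and_le {p : ℝ} (h0 : 0 ≤ p) (h1 : p ≤ 1) {P Q : (α → Bool) → Prop}
    (hP : ∀ a b, a ≤ b → P b → P a) (hQ : ∀ a b, a ≤ b → Q a → Q b) :
    prob p (fun ω => P ω ∧ Q ω) ≤ prob p P * prob p Q := by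
  classical
  have h := fkg (fun ω : α → Bool => if ¬ P ω then (1 : ℝ) else 0)
    (fun ω : α → Bool => if Q ω then (1 : ℝ) else 0) (bern p)
    (fun ω => bern_nonneg h0 h1 ω) (fun ω => by dsimp; positivity)
    (fun ω => by dsimp; positivity)
    (fun a b hab => by
      dsimp
      by_cases h : P b
      · simp [h, hP a b hab h]
      · simp only [h, not_false_eq_true, if_true]; split_ifs <;> norm_num)
    (fun a b hab => by
      dsimp
      by_cases h : Q a
      · simp [h, hQ a b hab h]
      · simp only [h, if_false]; positivity)
    (bern_mul_bern_le h0 le_rfl h1)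
  rw [sum_bern, one_mul] at h
  have h2 := prob_not p P
  have h3 : prob p (fun ω => P ω ∧ Q ω) + ∑ ω, bern p ω *
      ((if ¬ P ω then (1 : ℝ) else 0) * if Q ω then 1 else 0) = prob p Q := by
    rw [prob, prob, ← Finset.sum_add_distrib]
    refine Finset.sum_congr rfl fun ω _ => ?_
    by_cases h : P ω <;> by_cases h' : Q ω <;> simp [h, h']
  have h4 : (∑ ω, bern p ω * if ¬ P ω then (1 : ℝ) else 0) = 1 - prob p P := by
    rw [← h2, prob]
    refine Finset.sum_congr rfl fun ω _ => ?_
    congr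
  have h5 : (∑ ω, bern p ω * if Q ω then (1 : ℝ) else 0) = prob p Q := rfl
  rw [h4, h5] at h
  nlinarith

/-- Second moment method: the probability that none of the events `P i` occurs. -/
lemma prob_none_le_of_second_moment {p : ℝ} (h0 : 0 ≤ p) (h1 : p ≤ 1) {ι : Type*} (s : Finset ι)
    (P : ι → (α → Bool) → Prop) (hpos : 0 < ∑ i ∈ s, prob p (P i)) :
    prob p (fun ω => ∀ i ∈ s, ¬ P i ω) ≤
      (∑ i ∈ s, ∑ j ∈ s, prob p (fun ω => P i ω ∧ P j ω)) / (∑ i ∈ s, prob p (P i)) ^ 2 - 1 := by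
  classical
  set μ := ∑ i ∈ s, prob p (P i) with hμ
  set X : (α → Bool) → ℝ := fun ω => ∑ i ∈ s, if P i ω then 1 else 0 with hX
  have e1 : ∑ ω, bern p ω * X ω = μ := by
    simp only [hX, hμ, prob, Finset.mul_sum]
    rw [Finset.sum_comm]
  have e2 : ∑ ω, bern p ω * (X ω) ^ 2 = ∑ i ∈ s, ∑ j ∈ s, prob p (fun ω => P i ω ∧ P j ω) := by
    simp only [hX, prob, sq, Finset.sum_mul_sum]
    simp only [Finset.mul_sum]
    rw [Finset.sum_comm]
    refine Finset.sum_congr rfl fun i _ => ?_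
    rw [Finset.sum_comm]
    refine Finset.sum_congr rfl fun j _ => Finset.sum_congr rfl fun ω _ => ?_
    by_cases h : P i ω <;> by_cases h' : P j ω <;> simp [h, h']
  have e3 : ∑ ω, bern p ω * (X ω - μ) ^ 2 = ∑ ω, bern p ω * (X ω) ^ 2 - μ ^ 2 := by
    have : ∀ ω, bern p ω * (X ω - μ) ^ 2 =
        bern p ω * X ω ^ 2 - 2 * μ * (bern p ω * X ω) + μ ^ 2 * bern p ω := fun ω => by ring
    simp only [this, Finset.sum_add_distrib, Finset.sum_sub_distrib, ← Finset.mul_sum, e1, sum_bern]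
    ring
  have e4 : μ ^ 2 * prob p (fun ω => ∀ i ∈ s, ¬ P i ω) ≤ ∑ ω, bern p ω * (X ω - μ) ^ 2 := by
    rw [prob, Finset.mul_sum]
    refine Finset.sum_le_sum fun ω _ => ?_
    rw [mul_left_comm]
    refine mul_le_mul_of_nonneg_left ?_ (bern_nonneg h0 h1 ω)
    split_ifs with h
    · have : X ω = 0 := Finset.sum_eq_zero fun i hi => by simp [h i hi]
      simp [this]
    · rw [mul_zero]; positivity
  rw [e3, e2] at e4
  rw [le_sub_iff_add_le, le_div_iff₀ (by positivity)]
  nlinarith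

end Bernoulli

section Deterministic

variable {V : Type*} [Fintype V]

open Classical in
/-- The vertices outside `U` with a neighbour in `U`. -/
noncomputable def outerNbr (G : SimpleGraph V) (U : Finset V) : Finset V :=
  Finset.univ.filter fun w => w ∉ U ∧ ∃ u ∈ U, G.Adj u w

lemma mem_outerNbr {G : SimpleGraph V} {U : Finset V} {w : V} :
    w ∈ outerNbr G U ↔ w ∉ U ∧ ∃ u ∈ U, G.Adj u w := by
  simp [outerNbr]

/-- `w` is at distance at most one from `v`. -/
def Near (G : SimpleGraph V) (v w : V) : Prop := v = w ∨ G.Adj v w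

/-- `w` is at distance at most four from `v`. -/
def Close (G : SimpleGraph V) (v w : V) : Prop :=
  ∃ a, Near G v a ∧ ∃ b, Near G a b ∧ ∃ c, Near G b c ∧ Near G c w

/-- If low vertices are pairwise far apart and small sets of other vertices expand well, then all
small sets expand. -/
lemma card_le_card_outerNbr (G : SimpleGraph V) (Low : V → Prop) (θ : ℝ)
    (hnbr : ∀ v, ∃ w, G.Adj v w)
    (hfar : ∀ v w, v ≠ w → Low v → Low w → ¬ Close G v w)
    (hexp : ∀ U : Finset V, (∀ v ∈ U, ¬ Low v) → (U.card : ℝ) ≤ θ →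
      4 * U.card ≤ (outerNbr G U).card)
    (U : Finset V) (hU : (U.card : ℝ) ≤ θ) : U.card ≤ (outerNbr G U).card := by
  classical
  choose g hg using hnbr
  set U1 := U.filter Low
  set U2 := U.filter fun v => ¬ Low v
  set W1 := U1.filter fun v => g v ∈ U2
  set W2 := U1.filter fun v => g v ∉ U2
  have hlow : ∀ v ∈ U1, Low v := fun v hv => (Finset.mem_filter.mp hv).2
  have ginj : ∀ v ∈ U1, ∀ w ∈ U1, g v = g w → v = w := by
    intro v hv w hw h
    by_contra hne
    exact hfar v w hne (hlow v hv) (hlow w hw)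
      ⟨g v, .inr (hg v), w, .inr (h ▸ (hg w).symm), w, .inl rfl, .inl rfl⟩
  have c1 : U1.card + U2.card = U.card := Finset.card_filter_add_card_filter_not _
  have c2 : W1.card + W2.card = U1.card := Finset.card_filter_add_card_filter_not _
  have c3 : W1.card ≤ U2.card :=
    Finset.card_le_card_of_injOn g (fun v hv => (Finset.mem_filter.mp hv).2)
      fun v hv w hw h => ginj v (Finset.mem_filter.mp hv).1 w (Finset.mem_filter.mp hw).1 h
  have c4 : 4 * U2.card ≤ (outerNbr G U2).card :=
    hexp U2 (fun v hv => (Finset.mem_filter.mp hv).2)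
      ((Nat.cast_le.mpr (Finset.card_filter_le _ _)).trans hU)
  have hW2 : W2 ⊆ U1 := Finset.filter_subset _ _
  have c5 : (W2.image g).card = W2.card :=
    Finset.card_image_of_injOn fun v hv w hw h => ginj v (hW2 hv) w (hW2 hw) h
  have c6 : (outerNbr G U2 ∩ U1).card ≤ U2.card := by
    have : ∀ w ∈ outerNbr G U2 ∩ U1, ∃ u ∈ U2, G.Adj u w := fun w hw =>
      (mem_outerNbr.mp (Finset.mem_inter.mp hw).1).2
    choose! f hf hf' using this
    refine Finset.card_le_card_of_injOn f hf fun v hv w hw h => ?_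
    by_contra hne
    exact hfar v w hne (hlow v (Finset.mem_inter.mp hv).2) (hlow w (Finset.mem_inter.mp hw).2)
      ⟨f v, .inr (hf' v hv).symm, w, .inr (h ▸ hf' w hw), w, .inl rfl, .inl rfl⟩
  have c7 : (outerNbr G U2 ∩ W2.image g).card ≤ U2.card := by
    have : ∀ w ∈ outerNbr G U2 ∩ W2.image g, ∃ u ∈ U2, G.Adj u w := fun w hw =>
      (mem_outerNbr.mp (Finset.mem_inter.mp hw).1).2
    choose! f hf hf' using this
    refine Finset.card_le_card_of_injOn f hf fun v hv w hw h => ?_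
    obtain ⟨v', hv', rfl⟩ := Finset.mem_image.mp (Finset.mem_inter.mp hv).2
    obtain ⟨w', hw', rfl⟩ := Finset.mem_image.mp (Finset.mem_inter.mp hw).2
    by_contra hne
    exact hfar v' w' (fun h => hne (congrArg g h)) (hlow v' (hW2 hv')) (hlow w' (hW2 hw'))
      ⟨g v', .inr (hg v'), f (g v'), .inr (hf' _ hv).symm, g w', .inr (h ▸ hf' _ hw),
        .inr (hg w').symm⟩
  have gnot : ∀ v ∈ W2, g v ∉ U := by
    intro v hv hU
    have hv2 := (Finset.mem_filter.mp hv).2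
    by_cases hl : Low (g v)
    · exact hfar v (g v) (hg v).ne (hlow v (hW2 hv)) hl
        ⟨g v, .inr (hg v), g v, .inl rfl, g v, .inl rfl, .inl rfl⟩
    · exact hv2 (Finset.mem_filter.mpr ⟨hU, hl⟩)
  have hsub : W2.image g ∪ (outerNbr G U2 \ (U1 ∪ W2.image g)) ⊆ outerNbr G U := by
    intro w hw
    rw [mem_outerNbr]
    rcases Finset.mem_union.mp hw with hw | hw
    · obtain ⟨v, hv, rfl⟩ := Finset.mem_image.mp hw
      exact ⟨gnot v hv, v, (Finset.mem_filter.mp (hW2 hv)).1, hg v⟩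
    · obtain ⟨hw1, hw2⟩ := Finset.mem_sdiff.mp hw
      obtain ⟨hw3, u, hu, huw⟩ := mem_outerNbr.mp hw1
      refine ⟨fun hwU => ?_, u, (Finset.mem_filter.mp hu).1, huw⟩
      by_cases hl : Low w
      · exact hw2 (Finset.mem_union_left _ (Finset.mem_filter.mpr ⟨hwU, hl⟩))
      · exact hw3 (Finset.mem_filter.mpr ⟨hwU, hl⟩)
  have c8 := Finset.card_le_card hsub
  rw [Finset.card_union_of_disjoint (by
    refine Finset.disjoint_left.mpr fun w hw hw' => ?_
    exact (Finset.mem_sdiff.mp hw').2 (Finset.mem_union_right _ hw)), c5] at c8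
  have c9 : (outerNbr G U2).card ≤ (outerNbr G U2 \ (U1 ∪ W2.image g)).card +
      ((outerNbr G U2 ∩ U1).card + (outerNbr G U2 ∩ W2.image g).card) := by
    rw [← Finset.card_sdiff_add_card_inter (outerNbr G U2) (U1 ∪ W2.image g),
      Finset.inter_union_distrib_left]
    gcongr
    exact Finset.card_union_le _ _
  omega

/-- An expansion criterion for perfect matchings, deduced from Tutte's theorem. -/
lemma exists_isPerfectMatching_of_expansion (G : SimpleGraph V) (heven : Even (Fintype.card V))
    (b : ℝ) (hb : 0 < b) (hbn : 2 * b ≤ Fintype.card V)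
    (hexp : ∀ U : Finset V, (U.card : ℝ) < 2 * b → U.card ≤ (outerNbr G U).card)
    (hedge : ∀ A B : Finset V, Disjoint A B → b ≤ A.card → b ≤ B.card →
      ∃ v ∈ A, ∃ w ∈ B, G.Adj v w) :
    ∃ M : G.Subgraph, M.IsPerfectMatching := by
  classical
  rw [SimpleGraph.tutte]
  intro u hu
  rw [SimpleGraph.IsTutteViolator] at hu
  set D := (⊤ : G.Subgraph).deleteVerts u with hD
  have hverts : ∀ v, v ∈ D.verts ↔ v ∉ u := fun v => by simp [hD]
  have hcardW : Nat.card D.verts + u.ncard = Fintype.card V := by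
    have h1 : D.verts = uᶜ := by ext v; simp [hverts]
    rw [h1, Nat.card_coe_set_eq, Set.ncard_compl, Nat.card_eq_fintype_card]
    have : u.ncard ≤ Nat.card V := Set.ncard_le_card u
    rw [Nat.card_eq_fintype_card] at this
    omega
  have hodd := D.coe.odd_ncard_oddComponents
  set K := D.coe.ConnectedComponent
  have hK : D.coe.oddComponents.ncard ≤ Fintype.card K := by
    rw [← Nat.card_eq_fintype_card]
    exact Set.ncard_le_card _
  have hcardK : u.ncard + 2 ≤ Fintype.card K := by
    refine le_trans ?_ hK
    by_contra hlt
    have h1 : D.coe.oddComponents.ncard = u.ncard + 1 := by omega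
    rw [h1] at hodd
    have h2 : Even (Nat.card D.verts + u.ncard) := hcardW ▸ heven
    rw [Nat.even_add, ← Nat.not_odd_iff_even, ← Nat.not_odd_iff_even, ← hodd, Nat.odd_add_one] at h2
    tauto
  set A : Finset K → Finset V := fun T =>
    Finset.univ.filter fun v => ∃ h : v ∈ D.verts, D.coe.connectedComponentMk ⟨v, h⟩ ∈ T with hA
  have memA : ∀ T v, v ∈ A T ↔ ∃ h : v ∈ D.verts, D.coe.connectedComponentMk ⟨v, h⟩ ∈ T :=
    fun T v => by simp [hA]
  have hAcard : ∀ T, T.card ≤ (A T).card := by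
    intro T
    have : ∀ c : K, ∃ v : D.verts, D.coe.connectedComponentMk v = c := fun c => c.exists_rep
    choose r hr using this
    refine Finset.card_le_card_of_injOn (fun c => (r c : V)) (fun c hc => ?_) fun c _ d _ h => ?_
    · exact (memA _ _).mpr ⟨(r c).2, by simpa [hr] using hc⟩
    · rw [← hr c, ← hr d, Subtype.ext h]
  have hAadj : ∀ T v w, v ∈ A T → G.Adj v w → w ∈ u ∨ w ∈ A T := by
    intro T v w hv hvw
    obtain ⟨h, hT⟩ := (memA _ _).mp hv
    by_cases hw : w ∈ u
    · exact .inl hw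
    · refine .inr ((memA _ _).mpr ⟨(hverts w).mpr hw, ?_⟩)
      have : D.coe.Adj ⟨v, h⟩ ⟨w, (hverts w).mpr hw⟩ := by
        simp [hD, hvw, hw, (hverts v).mp h]
      rwa [← SimpleGraph.ConnectedComponent.sound this.reachable]
  have hAdisj : ∀ T T' v, Disjoint T T' → v ∈ A T → v ∉ A T' := by
    intro T T' v hd hv hv'
    obtain ⟨h, hT⟩ := (memA _ _).mp hv
    obtain ⟨h', hT'⟩ := (memA _ _).mp hv'
    exact Finset.disjoint_left.mp hd hT hT'
  have hAu : ∀ T v, v ∈ A T → v ∉ u := fun T v hv => by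
    obtain ⟨h, -⟩ := (memA _ _).mp hv
    exact (hverts v).mp h
  have hAuniv : b ≤ (A Finset.univ).card := by
    have h1 : (A Finset.univ).card = Nat.card D.verts := by
      rw [Nat.card_coe_set_eq, ← Set.ncard_coe_finset]
      congr 1; ext v; simp [memA]
    have h2 := hAcard Finset.univ
    rw [Finset.card_univ, h1] at h2
    rw [h1]
    have : (Nat.card D.verts : ℝ) + u.ncard = Fintype.card V := by exact_mod_cast hcardW
    have : (u.ncard : ℝ) + 2 ≤ Nat.card D.verts := by exact_mod_cast hcardK.trans h2
    linarith
  obtain ⟨T, hT, hmin⟩ := Finset.exists_min_image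
    (Finset.univ.filter fun T : Finset K => b ≤ (A T).card) Finset.card
    ⟨Finset.univ, by simpa using hAuniv⟩
  replace hT : b ≤ (A T).card := (Finset.mem_filter.mp hT).2
  have hTc : ((A Tᶜ).card : ℝ) < b := by
    by_contra hge
    obtain ⟨v, hv, w, hw, hvw⟩ := hedge (A T) (A Tᶜ)
      (Finset.disjoint_left.mpr fun v => hAdisj _ _ v disjoint_compl_right) hT (not_lt.mp hge)
    rcases hAadj T v w hv hvw with h | h
    · exact hAu _ _ hw h
    · exact hAdisj _ _ _ disjoint_compl_right h hw
  have hTne : T.Nonempty := by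
    by_contra hne
    rw [Finset.not_nonempty_iff_eq_empty] at hne
    subst hne
    have : A ∅ = ∅ := by ext v; simp [memA]
    rw [this] at hT
    simp at hT
    linarith
  obtain ⟨C, hC⟩ := hTne
  have hTC : ((A (T.erase C)).card : ℝ) < b := by
    by_contra hge
    have := hmin (T.erase C) (by simpa using hge)
    rw [Finset.card_erase_of_mem hC] at this
    have := Finset.card_pos.mpr ⟨C, hC⟩
    omega
  set U := A (Finset.univ.erase C)
  have hU : U ⊆ A Tᶜ ∪ A (T.erase C) := by
    intro v hv
    obtain ⟨h, hv⟩ := (memA _ _).mp hv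
    rw [Finset.mem_union, memA, memA]
    by_cases hvT : D.coe.connectedComponentMk ⟨v, h⟩ ∈ T
    · exact .inr ⟨h, Finset.mem_erase.mpr ⟨(Finset.mem_erase.mp hv).1, hvT⟩⟩
    · exact .inl ⟨h, by simpa using hvT⟩
  have hUcard : (U.card : ℝ) < 2 * b := by
    have h1 := (Finset.card_le_card hU).trans (Finset.card_union_le _ _)
    have : (U.card : ℝ) ≤ (A Tᶜ).card + (A (T.erase C)).card := by exact_mod_cast h1
    linarith
  have h1 := hexp U hUcard
  have h2 : (outerNbr G U).card ≤ u.ncard := by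
    rw [← Set.ncard_coe_finset]
    refine Set.ncard_le_ncard (fun w hw => ?_) u.toFinite
    obtain ⟨hw, v, hv, hvw⟩ := mem_outerNbr.mp hw
    exact (hAadj _ v w hv hvw).resolve_right hw
  have h3 := hAcard (Finset.univ.erase C)
  rw [Finset.card_erase_of_mem (Finset.mem_univ _), Finset.card_univ] at h3
  have h4 : Fintype.card K - 1 ≤ U.card := h3
  omega

end Deterministic

section Counting

open Classical

variable {k n : ℕ} {H : SimpleGraph (Fin k)}

lemma graphOf_adj {ω : Copy H n → Bool} {v w : Fin n} :
    (graphOf ω).Adj v w ↔ ∃ c, ω c = true ∧ c.1.Adj v w := by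
  rw [graphOf, SimpleGraph.iSup_adj]
  refine exists_congr fun c => ?_
  by_cases h : ω c = true <;> simp [h]

/-- The image of a copy under a permutation of the vertices. -/
noncomputable def Copy.perm (σ : Equiv.Perm (Fin n)) (c : Copy H n) : Copy H n :=
  ⟨c.1.map σ.toEmbedding, by
    obtain ⟨f, hf⟩ := c.2
    exact ⟨f.trans σ.toEmbedding, by rw [hf, SimpleGraph.map_map]; rfl⟩⟩

lemma Copy.perm_injective (σ : Equiv.Perm (Fin n)) :
    Function.Injective (Copy.perm (H := H) σ) := fun _ _ h =>
  Subtype.ext (SimpleGraph.map_injective _ (congrArg Subtype.val h))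

lemma Copy.perm_adj (σ : Equiv.Perm (Fin n)) (c : Copy H n) (v w : Fin n) :
    (c.perm σ).1.Adj (σ v) (σ w) ↔ c.1.Adj v w :=
  SimpleGraph.map_adj_apply (f := σ.toEmbedding)

lemma Copy.perm_support {σ : Equiv.Perm (Fin n)} {c : Copy H n} {v : Fin n}
    (h : v ∈ c.1.support) : σ v ∈ (c.perm σ).1.support := by
  obtain ⟨w, hw⟩ := h
  exact ⟨σ w, (Copy.perm_adj σ c v w).mpr hw⟩

/-- The vertex set of a copy. -/
noncomputable def Copy.verts (c : Copy H n) : Finset (Fin n) :=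
  Finset.univ.filter fun v => v ∈ c.1.support

lemma Copy.mem_verts {c : Copy H n} {v : Fin n} : v ∈ c.verts ↔ ∃ w, c.1.Adj v w := by
  simp [Copy.verts, SimpleGraph.mem_support]

lemma Copy.perm_verts {σ : Equiv.Perm (Fin n)} {c : Copy H n} {v : Fin n}
    (h : v ∈ c.verts) : σ v ∈ (c.perm σ).verts := by
  simp only [Copy.verts, Finset.mem_filter, Finset.mem_univ, true_and] at h ⊢
  exact Copy.perm_support h

lemma Copy.card_verts (hiso : ∀ v, (H.neighborSet v).Nonempty) (c : Copy H n) :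
    c.verts.card = k := by
  obtain ⟨f, hf⟩ := c.2
  have : c.verts = Finset.univ.map f := by
    ext v
    rw [Copy.mem_verts, hf]
    simp only [SimpleGraph.map_adj, Finset.mem_map, Finset.mem_univ, true_and]
    constructor
    · rintro ⟨w, a, b, -, rfl, -⟩
      exact ⟨a, rfl⟩
    · rintro ⟨a, rfl⟩
      obtain ⟨b, hb⟩ := hiso a
      exact ⟨f b, a, b, hb, rfl, rfl⟩
  simp [this]

variable (H) in
/-- The copies through a vertex. -/
noncomputable def copiesAt (v : Fin n) : Finset (Copy H n) :=
  Finset.univ.filter fun c => v ∈ c.verts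

variable (H) in
/-- The copies through two vertices. -/
noncomputable def copiesAt₂ (v w : Fin n) : Finset (Copy H n) :=
  Finset.univ.filter fun c => v ∈ c.verts ∧ w ∈ c.verts

variable (H) in
/-- The copies containing a given edge. -/
noncomputable def copiesEdge (v w : Fin n) : Finset (Copy H n) :=
  Finset.univ.filter fun c => c.1.Adj v w

lemma mem_copiesAt {v : Fin n} {c : Copy H n} : c ∈ copiesAt H v ↔ v ∈ c.verts := by
  simp [copiesAt]

lemma mem_copiesAt₂ {v w : Fin n} {c : Copy H n} :
    c ∈ copiesAt₂ H v w ↔ v ∈ c.verts ∧ w ∈ c.verts := by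
  simp [copiesAt₂]

lemma mem_copiesEdge {v w : Fin n} {c : Copy H n} : c ∈ copiesEdge H v w ↔ c.1.Adj v w := by
  simp [copiesEdge]

lemma exists_perm_pair {v w v' w' : Fin n} (h : v ≠ w) (h' : v' ≠ w') :
    ∃ σ : Equiv.Perm (Fin n), σ v = v' ∧ σ w = w' := by
  have h1 : Equiv.swap v v' w ≠ v' := by
    intro he
    rw [Equiv.swap_apply_eq_iff, Equiv.swap_apply_right] at he
    exact h he.symm
  refine ⟨Equiv.swap (Equiv.swap v v' w) w' * Equiv.swap v v', ?_, ?_⟩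
  · rw [Equiv.Perm.mul_apply, Equiv.swap_apply_left, Equiv.swap_apply_of_ne_of_ne h1.symm h']
  · rw [Equiv.Perm.mul_apply, Equiv.swap_apply_left]

lemma card_copiesAt_eq (v w : Fin n) : (copiesAt H v).card = (copiesAt H w).card := by
  have : ∀ v w : Fin n, (copiesAt H v).card ≤ (copiesAt H w).card := fun v w => by
    refine Finset.card_le_card_of_injOn (Copy.perm (Equiv.swap v w)) (fun c hc => ?_)
      (Copy.perm_injective _).injOn
    have := Copy.perm_verts (σ := Equiv.swap v w) (mem_copiesAt.mp hc)
    rw [Equiv.swap_apply_left] at this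
    exact mem_copiesAt.mpr this
  exact le_antisymm (this v w) (this w v)

lemma card_copiesAt₂_eq {v w v' w' : Fin n} (h : v ≠ w) (h' : v' ≠ w') :
    (copiesAt₂ H v w).card = (copiesAt₂ H v' w').card := by
  have : ∀ {v w v' w' : Fin n}, v ≠ w → v' ≠ w' →
      (copiesAt₂ H v w).card ≤ (copiesAt₂ H v' w').card := fun {v w v' w'} h h' => by
    obtain ⟨σ, h1, h2⟩ := exists_perm_pair h h'
    refine Finset.card_le_card_of_injOn (Copy.perm σ) (fun c hc => ?_)
      (Copy.perm_injective _).injOn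
    obtain ⟨hv, hw⟩ := mem_copiesAt₂.mp hc
    exact mem_copiesAt₂.mpr ⟨h1 ▸ Copy.perm_verts hv, h2 ▸ Copy.perm_verts hw⟩
  exact le_antisymm (this h h') (this h' h)

lemma card_copiesEdge_eq {v w v' w' : Fin n} (h : v ≠ w) (h' : v' ≠ w') :
    (copiesEdge H v w).card = (copiesEdge H v' w').card := by
  have : ∀ {v w v' w' : Fin n}, v ≠ w → v' ≠ w' →
      (copiesEdge H v w).card ≤ (copiesEdge H v' w').card := fun {v w v' w'} h h' => by
    obtain ⟨σ, h1, h2⟩ := exists_perm_pair h h'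
    refine Finset.card_le_card_of_injOn (Copy.perm σ) (fun c hc => ?_)
      (Copy.perm_injective _).injOn
    have := (Copy.perm_adj σ c v w).mpr (mem_copiesEdge.mp hc)
    rw [h1, h2] at this
    exact mem_copiesEdge.mpr this
  exact le_antisymm (this h h') (this h' h)

lemma card_copiesAt (v : Fin n) : (copiesAt H v).card = mr H n 1 := by
  have hn : 0 < n := v.pos
  rw [card_copiesAt_eq v ⟨0, hn⟩, mr, ← Nat.card_congr (Equiv.subtypeSubtypeEquivSubtypeInter
    (IsCopy H) fun G => ∃ v ∈ G.support, (v : ℕ) < 1), Nat.card_eq_fintype_card,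
    Fintype.card_subtype, copiesAt]
  congr 1
  ext c
  simp only [Finset.mem_filter, Finset.mem_univ, true_and, Copy.verts]
  constructor
  · exact fun h => ⟨_, h, by simp⟩
  · rintro ⟨v, hv, hv0⟩
    have : v = ⟨0, hn⟩ := Fin.ext (Nat.lt_one_iff.mp hv0)
    exact this ▸ hv

lemma card_copiesAt₂ (hiso : ∀ v, (H.neighborSet v).Nonempty) {v w : Fin n} (h : v ≠ w) :
    (n - 1) * (copiesAt₂ H v w).card = (k - 1) * mr H n 1 := by
  have h1 := Finset.sum_card_bipartiteAbove_eq_sum_card_bipartiteBelow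
    (s := Finset.univ.erase v) (t := copiesAt H v) (fun w c => w ∈ c.verts)
  have h2 : ∀ w' ∈ Finset.univ.erase v, ((copiesAt H v).bipartiteAbove
      (fun w c => w ∈ c.verts) w').card = (copiesAt₂ H v w).card := by
    intro w' hw'
    rw [card_copiesAt₂_eq h (Finset.ne_of_mem_erase hw').symm]
    congr 1
    ext c
    simp [Finset.bipartiteAbove, mem_copiesAt, mem_copiesAt₂]
  have h3 : ∀ c ∈ copiesAt H v, ((Finset.univ.erase v).bipartiteBelow
      (fun w (c : Copy H n) => w ∈ c.verts) c).card = k - 1 := by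
    intro c hc
    have h4 := Finset.card_erase_of_mem (mem_copiesAt.mp hc)
    rw [Copy.card_verts hiso c] at h4
    rw [← h4]
    congr 1
    ext w
    simp [Finset.bipartiteBelow]
  rw [Finset.sum_congr rfl h2, Finset.sum_congr rfl h3] at h1
  simpa [card_copiesAt, mul_comm] using h1

lemma le_card_copiesEdge {v w : Fin n} (h : v ≠ w) :
    mr H n 1 ≤ (n - 1) * (copiesEdge H v w).card := by
  have h1 := Finset.sum_card_bipartiteAbove_eq_sum_card_bipartiteBelow
    (s := Finset.univ.erase v) (t := copiesAt H v) (fun w c => c.1.Adj v w)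
  have h2 : ∀ w' ∈ Finset.univ.erase v, ((copiesAt H v).bipartiteAbove
      (fun w c => c.1.Adj v w) w').card = (copiesEdge H v w).card := by
    intro w' hw'
    rw [card_copiesEdge_eq h (Finset.ne_of_mem_erase hw').symm]
    congr 1
    ext c
    simp only [Finset.bipartiteAbove, Finset.mem_filter, mem_copiesAt, mem_copiesEdge,
      Copy.mem_verts]
    exact ⟨fun h => h.2, fun h => ⟨⟨_, h⟩, h⟩⟩
  have h3 : ∀ c ∈ copiesAt H v, 1 ≤ ((Finset.univ.erase v).bipartiteBelow
      (fun w (c : Copy H n) => c.1.Adj v w) c).card := by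
    intro c hc
    obtain ⟨w, hw⟩ := Copy.mem_verts.mp (mem_copiesAt.mp hc)
    exact Finset.card_pos.mpr ⟨w, by simp [Finset.bipartiteBelow, hw, hw.ne']⟩
  rw [Finset.sum_congr rfl h2] at h1
  have h4 := Finset.sum_le_sum h3
  rw [← h1] at h4
  simpa [card_copiesAt] using h4

/-- Many copies have an edge between two given large sets. -/
lemma le_card_copies_between (hiso : ∀ v, (H.neighborSet v).Nonempty) {A B : Finset (Fin n)}
    (hAB : Disjoint A B) :
    A.card * B.card * mr H n 1 ≤
      (n - 1) * (k ^ 2 * (Finset.univ.filter fun c : Copy H n =>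
        ∃ v ∈ A, ∃ w ∈ B, c.1.Adj v w).card) := by
  set F := Finset.univ.filter fun c : Copy H n => ∃ v ∈ A, ∃ w ∈ B, c.1.Adj v w with hF
  have h1 := Finset.sum_card_bipartiteAbove_eq_sum_card_bipartiteBelow
    (s := A ×ˢ B) (t := F) (fun x c => c.1.Adj x.1 x.2)
  have h2 : ∀ x ∈ A ×ˢ B, mr H n 1 ≤ (n - 1) * (F.bipartiteAbove
      (fun x c => c.1.Adj x.1 x.2) x).card := by
    intro x hx
    obtain ⟨hxA, hxB⟩ := Finset.mem_product.mp hx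
    refine (le_card_copiesEdge (H := H) (Finset.disjoint_iff_ne.mp hAB _ hxA _ hxB)).trans ?_
    gcongr
    intro c hc
    rw [mem_copiesEdge] at hc
    simp only [Finset.bipartiteAbove, Finset.mem_filter, hF, Finset.mem_univ, true_and]
    exact ⟨⟨_, hxA, _, hxB, hc⟩, hc⟩
  have h3 : ∀ c ∈ F, ((A ×ˢ B).bipartiteBelow
      (fun x (c : Copy H n) => c.1.Adj x.1 x.2) c).card ≤ k ^ 2 := by
    intro c hc
    have h4 : (c.verts ×ˢ c.verts).card = k ^ 2 := by
      rw [Finset.card_product, Copy.card_verts hiso c, sq]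
    rw [← h4]
    refine Finset.card_le_card fun x hx => ?_
    have hx := (Finset.mem_filter.mp hx).2
    exact Finset.mem_product.mpr ⟨Copy.mem_verts.mpr ⟨_, hx⟩, Copy.mem_verts.mpr ⟨_, hx.symm⟩⟩
  calc A.card * B.card * mr H n 1 = ∑ x ∈ A ×ˢ B, mr H n 1 := by simp
    _ ≤ _ := Finset.sum_le_sum h2
    _ = (n - 1) * ∑ c ∈ F, ((A ×ˢ B).bipartiteBelow
      (fun x (c : Copy H n) => c.1.Adj x.1 x.2) c).card := by rw [← Finset.mul_sum, h1]
    _ ≤ (n - 1) * (F.card * k ^ 2) := by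
        gcongr
        simpa using Finset.sum_le_sum h3
    _ = _ := by ring

/-- Few copies meet a small set in two vertices. -/
lemma card_copies_two_le (hiso : ∀ v, (H.neighborSet v).Nonempty) (Z : Finset (Fin n)) :
    (n - 1) * (Finset.univ.filter fun c : Copy H n =>
        ∃ v ∈ Z, ∃ w ∈ Z, v ≠ w ∧ v ∈ c.verts ∧ w ∈ c.verts).card ≤
      Z.card ^ 2 * ((k - 1) * mr H n 1) := by
  have h1 : (Finset.univ.filter fun c : Copy H n =>
        ∃ v ∈ Z, ∃ w ∈ Z, v ≠ w ∧ v ∈ c.verts ∧ w ∈ c.verts) ⊆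
      Z.offDiag.biUnion fun x => copiesAt₂ H x.1 x.2 := by
    intro c hc
    obtain ⟨v, hv, w, hw, hne, h⟩ := (Finset.mem_filter.mp hc).2
    exact Finset.mem_biUnion.mpr ⟨(v, w), Finset.mem_offDiag.mpr ⟨hv, hw, hne⟩,
      mem_copiesAt₂.mpr h⟩
  calc _ ≤ (n - 1) * ∑ x ∈ Z.offDiag, (copiesAt₂ H x.1 x.2).card := by
        gcongr
        exact (Finset.card_le_card h1).trans Finset.card_biUnion_le
    _ = ∑ x ∈ Z.offDiag, (k - 1) * mr H n 1 := by
        rw [Finset.mul_sum]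
        exact Finset.sum_congr rfl fun x hx =>
          card_copiesAt₂ hiso (Finset.mem_offDiag.mp hx).2.2
    _ = Z.offDiag.card * ((k - 1) * mr H n 1) := by simp
    _ ≤ _ := by
        gcongr
        rw [Finset.offDiag_card, sq]
        omega

lemma two_le_of_neighbor (hk : 0 < k) (hiso : ∀ v, (H.neighborSet v).Nonempty) : 2 ≤ k := by
  obtain ⟨w, hw⟩ := hiso ⟨0, hk⟩
  have hne : (⟨0, hk⟩ : Fin k) ≠ w := SimpleGraph.Adj.ne hw
  have := w.2
  have : (w : ℕ) ≠ 0 := fun h => hne (Fin.ext h.symm)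
  omega

lemma le_mr (hk : 0 < k) (hiso : ∀ v, (H.neighborSet v).Nonempty) (hkn : k ≤ n) :
    n - 1 ≤ (k - 1) * mr H n 1 := by
  have hk2 := two_le_of_neighbor hk hiso
  set f : Fin k ↪ Fin n := Fin.castLEEmb hkn
  obtain ⟨w, hw⟩ := hiso ⟨0, hk⟩
  have hw : H.Adj ⟨0, hk⟩ w := hw
  have hadj : (H.map f).Adj (f ⟨0, hk⟩) (f w) := SimpleGraph.map_adj_apply.mpr hw
  rw [← card_copiesAt₂ hiso hadj.ne]
  refine Nat.le_mul_of_pos_right _ (Finset.card_pos.mpr ⟨⟨H.map f, f, rfl⟩, ?_⟩)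
  rw [mem_copiesAt₂, Copy.mem_verts, Copy.mem_verts]
  exact ⟨⟨_, hadj⟩, _, hadj.symm⟩

lemma card_copiesAt_union (v w : Fin n) :
    (copiesAt H v ∪ copiesAt H w).card + (copiesAt₂ H v w).card = 2 * mr H n 1 := by
  have : copiesAt₂ H v w = copiesAt H v ∩ copiesAt H w := by
    ext c
    rw [Finset.mem_inter, mem_copiesAt₂, mem_copiesAt, mem_copiesAt]
  rw [this, Finset.card_union_add_card_inter, card_copiesAt, card_copiesAt, two_mul]

end Counting

section Bounds

open Classical

variable {k n : ℕ} {H : SimpleGraph (Fin k)}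

variable (H) in
/-- The copies with an edge between `A` and `B`. -/
noncomputable def copiesBetween (A B : Finset (Fin n)) : Finset (Copy H n) :=
  Finset.univ.filter fun c => ∃ v ∈ A, ∃ w ∈ B, c.1.Adj v w

variable (H) in
/-- The copies with at least two vertices in `Z`. -/
noncomputable def copiesTwo (Z : Finset (Fin n)) : Finset (Copy H n) :=
  Finset.univ.filter fun c => ∃ v ∈ Z, ∃ w ∈ Z, v ≠ w ∧ v ∈ c.verts ∧ w ∈ c.verts

/-- The selected members of a family of copies. -/
noncomputable def sel (ω : Copy H n → Bool) (S : Finset (Copy H n)) : Finset (Copy H n) :=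
  S.filter fun c => ω c = true

lemma mem_sel {ω : Copy H n → Bool} {S : Finset (Copy H n)} {c : Copy H n} :
    c ∈ sel ω S ↔ c ∈ S ∧ ω c = true := by
  simp [sel]

lemma sel_mono {ω ω' : Copy H n → Bool} (h : ω ≤ ω') (S : Finset (Copy H n)) :
    sel ω S ⊆ sel ω' S := fun c hc => by
  obtain ⟨h1, h2⟩ := mem_sel.mp hc
  exact mem_sel.mpr ⟨h1, Bool.eq_true_of_true_le (h2 ▸ h c)⟩

lemma graphOf_mono {ω ω' : Copy H n → Bool} (h : ω ≤ ω') : graphOf ω ≤ graphOf ω' := by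
  intro v w hvw
  obtain ⟨c, hc, hadj⟩ := graphOf_adj.mp hvw
  exact graphOf_adj.mpr ⟨c, Bool.eq_true_of_true_le (hc ▸ h c), hadj⟩

lemma Near.mono {V : Type*} {G G' : SimpleGraph V} (h : G ≤ G') {v w : V} (hn : Near G v w) :
    Near G' v w :=
  Or.imp_right (fun h' => h h') hn

lemma Close.mono {V : Type*} {G G' : SimpleGraph V} (h : G ≤ G') {v w : V} (hc : Close G v w) :
    Close G' v w := by
  obtain ⟨a, ha, b, hb, c, hc, hd⟩ := hc
  exact ⟨a, ha.mono h, b, hb.mono h, c, hc.mono h, hd.mono h⟩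

variable {p lam : ℝ}

lemma prob_isolated_le (h0 : 0 ≤ p) (h1 : p ≤ 1) (hlam : mr H n 1 * p = lam) :
    prob p (fun ω : Copy H n → Bool => ∃ v, ∀ c ∈ copiesAt H v, ω c = false) ≤
      n * Real.exp (-lam) := by
  calc _ ≤ prob p (fun ω : Copy H n → Bool => ∃ v ∈ Finset.univ, ∀ c ∈ copiesAt H v, ω c = false) :=
        prob_mono h0 h1 fun ω h => by simpa using h
    _ ≤ ∑ v : Fin n, prob p (fun ω => ∀ c ∈ copiesAt H v, ω c = false) :=
        prob_exists_le h0 h1 _ _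
    _ ≤ ∑ v : Fin n, Real.exp (-lam) := by
        refine Finset.sum_le_sum fun v _ => (prob_none_le h1 _).trans_eq ?_
        rw [card_copiesAt, ← hlam, mul_comm]
    _ = _ := by simp

lemma mul_card_copiesAt₂_le (hiso : ∀ v, (H.neighborSet v).Nonempty) (hk : 0 < k)
    (hlam : mr H n 1 * p = lam) (hn : 2 ≤ n)
    (hsmall : lam * k ≤ n - 1) (hlam0 : 0 ≤ lam) {v w : Fin n} (hvw : v ≠ w) :
    p * (copiesAt₂ H v w).card ≤ 1 := by
  have h2 : ((n : ℝ) - 1) * (copiesAt₂ H v w).card = (k - 1) * mr H n 1 := by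
    have := card_copiesAt₂ (H := H) hiso hvw
    have h3 : ((n - 1 : ℕ) : ℝ) * (copiesAt₂ H v w).card = ((k - 1 : ℕ) : ℝ) * mr H n 1 := by
      exact_mod_cast this
    rwa [Nat.cast_sub (by omega), Nat.cast_sub hk, Nat.cast_one] at h3
  have hn1 : (0 : ℝ) < n - 1 := by
    have : (2 : ℝ) ≤ n := by exact_mod_cast hn
    linarith
  have h3 : ((n : ℝ) - 1) * (p * (copiesAt₂ H v w).card) ≤ (n - 1) * 1 := by
    calc _ = p * ((n - 1) * (copiesAt₂ H v w).card) := by ring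
      _ = (k - 1) * lam := by rw [h2, ← hlam]; ring
      _ ≤ _ := by linarith
  exact le_of_mul_le_mul_left h3 hn1

lemma prob_low_low_le (hiso : ∀ v, (H.neighborSet v).Nonempty) (hk : 0 < k)
    (h0 : 0 ≤ p) (h1 : p ≤ 1) (hlam : mr H n 1 * p = lam) (hn : 2 ≤ n)
    (hsmall : lam * k ≤ n - 1) (hlam1 : 1 ≤ lam) (D : ℕ) {v w : Fin n} (hvw : v ≠ w) :
    prob p (fun ω : Copy H n → Bool =>
      (sel ω (copiesAt H v)).card < D ∧ (sel ω (copiesAt H w)).card < D) ≤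
      (2 * D : ℕ) * ((2 * lam) ^ (2 * D) * Real.exp (2 * D : ℕ) * Real.exp (1 - 2 * lam)) := by
  have hU : ((copiesAt H v ∪ copiesAt H w).card : ℝ) + (copiesAt₂ H v w).card = 2 * mr H n 1 := by
    exact_mod_cast card_copiesAt_union (H := H) v w
  have h2 := mul_card_copiesAt₂_le hiso hk hlam hn hsmall (by linarith) hvw
  have hU' : p * (copiesAt H v ∪ copiesAt H w).card =
      2 * lam - p * (copiesAt₂ H v w).card := by
    rw [← hlam]; linear_combination p * hU
  calc _ ≤ prob p (fun ω : Copy H n → Bool =>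
        ((copiesAt H v ∪ copiesAt H w).filter fun c => ω c = true).card < 2 * D) := by
        refine prob_mono h0 h1 fun ω h => ?_
        have : ((copiesAt H v ∪ copiesAt H w).filter fun c => ω c = true).card ≤
            (sel ω (copiesAt H v)).card + (sel ω (copiesAt H w)).card := by
          rw [Finset.filter_union]
          exact Finset.card_union_le _ _
        omega
    _ ≤ _ := prob_few_le h0 h1 _ (2 * D) (x := 2 * lam)
        (by rw [mul_comm, hU']; have : 0 ≤ p * (copiesAt₂ H v w).card := by positivity
            linarith) (by linarith)
    _ ≤ _ := by
        gcongr
        linarith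

lemma prob_degree_ge_le (h0 : 0 ≤ p) (h1 : p ≤ 1) (hlam : mr H n 1 * p = lam) (t : ℕ) :
    prob p (fun ω : Copy H n → Bool => ∃ v, t ≤ (sel ω (copiesAt H v)).card) ≤
      n * (Real.exp 1 * lam / t) ^ t := by
  calc _ ≤ prob p (fun ω : Copy H n → Bool => ∃ v ∈ Finset.univ, t ≤ (sel ω (copiesAt H v)).card) :=
        prob_mono h0 h1 fun ω h => by simpa using h
    _ ≤ ∑ v : Fin n, prob p (fun ω => t ≤ (sel ω (copiesAt H v)).card) :=
        prob_exists_le h0 h1 _ _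
    _ ≤ ∑ v : Fin n, (Real.exp 1 * lam / t) ^ t :=
        Finset.sum_le_sum fun v _ => prob_many_le h0 h1 _ t (by rw [card_copiesAt, hlam])
    _ = _ := by simp

lemma card_near_le (hiso : ∀ v, (H.neighborSet v).Nonempty) (ω : Copy H n → Bool) (t : ℕ)
    (v : Fin n) (h : (sel ω (copiesAt H v)).card < t) :
    (Finset.univ.filter fun w => Near (graphOf ω) v w).card ≤ 1 + k * t := by
  have hsub : (Finset.univ.filter fun w => Near (graphOf ω) v w) ⊆
      {v} ∪ (sel ω (copiesAt H v)).biUnion Copy.verts := by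
    intro w hw
    rcases (Finset.mem_filter.mp hw).2 with rfl | hw
    · simp
    · obtain ⟨c, hc, hadj⟩ := graphOf_adj.mp hw
      refine Finset.mem_union_right _ (Finset.mem_biUnion.mpr ⟨c, mem_sel.mpr ⟨?_, hc⟩, ?_⟩)
      · exact mem_copiesAt.mpr (Copy.mem_verts.mpr ⟨_, hadj⟩)
      · exact Copy.mem_verts.mpr ⟨_, hadj.symm⟩
  calc _ ≤ _ := Finset.card_le_card hsub
    _ ≤ 1 + ∑ c ∈ sel ω (copiesAt H v), c.verts.card :=
        (Finset.card_union_le _ _).trans (by gcongr; simp; exact Finset.card_biUnion_le)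
    _ = 1 + (sel ω (copiesAt H v)).card * k := by
        rw [Finset.sum_congr rfl fun c _ => Copy.card_verts hiso c]; simp
    _ ≤ _ := by rw [mul_comm]; gcongr

lemma card_close_le {V : Type*} [Fintype V] (G : SimpleGraph V) (d : ℕ)
    (h : ∀ v, (Finset.univ.filter fun w => Near G v w).card ≤ d) (v : V) :
    (Finset.univ.filter fun w => Close G v w).card ≤ d ^ 4 := by
  set N : V → Finset V := fun v => Finset.univ.filter fun w => Near G v w with hN
  have hsub : (Finset.univ.filter fun w => Close G v w) ⊆
      (N v).biUnion fun a => (N a).biUnion fun b => (N b).biUnion N := by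
    intro w hw
    obtain ⟨a, ha, b, hb, c, hc, hd⟩ := (Finset.mem_filter.mp hw).2
    simp only [Finset.mem_biUnion, hN, Finset.mem_filter, Finset.mem_univ, true_and]
    exact ⟨a, ha, b, hb, c, hc, hd⟩
  have hb : ∀ (S : Finset V) (f : V → Finset V) (m : ℕ), (∀ v, (f v).card ≤ m) →
      (S.biUnion f).card ≤ S.card * m := fun S f m hf =>
    Finset.card_biUnion_le_card_mul _ _ _ fun v _ => hf v
  calc _ ≤ _ := Finset.card_le_card hsub
    _ ≤ (N v).card * (d * (d * d)) :=
        hb _ _ _ fun a => (hb _ _ _ fun b => (hb _ _ _ h).trans (Nat.mul_le_mul_right _ (h b))).trans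
          (Nat.mul_le_mul_right _ (h a))
    _ ≤ d * (d * (d * d)) := Nat.mul_le_mul_right _ (h v)
    _ = d ^ 4 := by ring

lemma sum_prob_close_le (hiso : ∀ v, (H.neighborSet v).Nonempty)
    (h0 : 0 ≤ p) (h1 : p ≤ 1) (hlam : mr H n 1 * p = lam) (t : ℕ) :
    ∑ v : Fin n, ∑ w : Fin n, prob p (fun ω : Copy H n → Bool => Close (graphOf ω) v w) ≤
      n * (1 + k * t) ^ 4 + n ^ 2 * (n * (Real.exp 1 * lam / t) ^ t) := by
  have key : ∀ v : Fin n, ∑ w : Fin n,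
      prob p (fun ω : Copy H n → Bool => Close (graphOf ω) v w) ≤
      (1 + k * t) ^ 4 + n * (n * (Real.exp 1 * lam / t) ^ t) := fun v => by
    refine (sum_prob_le h0 h1 Finset.univ (fun w ω => Close (graphOf ω) v w)
      (fun ω : Copy H n → Bool => ∃ v, t ≤ (sel ω (copiesAt H v)).card)
      (a := (1 + k * t) ^ 4) (by positivity) fun ω hω => ?_).trans ?_
    · have hω := fun v => not_le.mp fun h => hω ⟨v, h⟩
      have := card_close_le (graphOf ω) (1 + k * t)
        (fun v => card_near_le hiso ω t v (hω v)) v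
      exact_mod_cast this
    · rw [Finset.card_univ, Fintype.card_fin]
      have := prob_degree_ge_le h0 h1 hlam t
      gcongr
  calc _ ≤ ∑ v : Fin n, (((1 : ℝ) + k * t) ^ 4 + n * (n * (Real.exp 1 * lam / t) ^ t)) :=
        Finset.sum_le_sum fun v _ => key v
    _ = _ := by
        rw [Finset.sum_const, Finset.card_univ, Fintype.card_fin, nsmul_eq_mul]
        ring

lemma prob_low_close_le (hiso : ∀ v, (H.neighborSet v).Nonempty) (hk : 0 < k)
    (h0 : 0 ≤ p) (h1 : p ≤ 1) (hlam : mr H n 1 * p = lam) (hn : 2 ≤ n)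
    (hsmall : lam * k ≤ n - 1) (hlam1 : 1 ≤ lam) (D t : ℕ) :
    prob p (fun ω : Copy H n → Bool => ∃ v w, v ≠ w ∧
      ((sel ω (copiesAt H v)).card < D ∧ (sel ω (copiesAt H w)).card < D) ∧
        Close (graphOf ω) v w) ≤
      (2 * D : ℕ) * ((2 * lam) ^ (2 * D) * Real.exp (2 * D : ℕ) * Real.exp (1 - 2 * lam)) *
      (n * (1 + k * t) ^ 4 + n ^ 2 * (n * (Real.exp 1 * lam / t) ^ t)) := by
  set q := (2 * D : ℕ) * ((2 * lam) ^ (2 * D) * Real.exp (2 * D : ℕ) * Real.exp (1 - 2 * lam))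
  have hq : 0 ≤ q := by positivity
  calc _ ≤ prob p (fun ω : Copy H n → Bool => ∃ x ∈ Finset.univ.filter
        (fun x : Fin n × Fin n => x.1 ≠ x.2),
      ((sel ω (copiesAt H x.1)).card < D ∧ (sel ω (copiesAt H x.2)).card < D) ∧
        Close (graphOf ω) x.1 x.2) := by
        refine prob_mono h0 h1 fun ω ⟨v, w, hne, h⟩ => ⟨(v, w), by simpa using hne, h⟩
    _ ≤ ∑ x ∈ Finset.univ.filter (fun x : Fin n × Fin n => x.1 ≠ x.2),
        q * prob p (fun ω : Copy H n → Bool => Close (graphOf ω) x.1 x.2) := by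
        refine (prob_exists_le h0 h1 _ _).trans (Finset.sum_le_sum fun x hx => ?_)
        refine (prob_and_le h0 h1 ?_ ?_).trans ?_
        · intro a b hab h
          exact ⟨(Finset.card_le_card (sel_mono hab _)).trans_lt h.1,
            (Finset.card_le_card (sel_mono hab _)).trans_lt h.2⟩
        · intro a b hab h
          exact h.mono (graphOf_mono hab)
        · exact mul_le_mul_of_nonneg_right (prob_low_low_le hiso hk h0 h1 hlam hn hsmall hlam1 D
            (Finset.mem_filter.mp hx).2) (prob_nonneg h0 h1 _)
    _ ≤ ∑ x : Fin n × Fin n,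
        q * prob p (fun ω : Copy H n → Bool => Close (graphOf ω) x.1 x.2) :=
        Finset.sum_le_sum_of_subset_of_nonneg (Finset.filter_subset _ _)
          fun x _ _ => mul_nonneg hq (prob_nonneg h0 h1 _)
    _ = q * ∑ v : Fin n, ∑ w : Fin n,
        prob p (fun ω : Copy H n → Bool => Close (graphOf ω) v w) := by
        rw [← Finset.mul_sum, Fintype.sum_prod_type]
    _ ≤ _ := mul_le_mul_of_nonneg_left (sum_prob_close_le hiso h0 h1 hlam t) hq

end Bounds

section Unions

open Classical

lemma choose_le_exp_mul_div_pow (n a : ℕ) (ha : 1 ≤ a) :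
    (n.choose a : ℝ) ≤ (Real.exp 1 * n / a) ^ a := by
  have ha' : (0 : ℝ) < a := by exact_mod_cast ha
  have h1 : (n.choose a : ℝ) ≤ (n : ℝ) ^ a / a.factorial := Nat.choose_le_pow_div a n
  have h2 : (a : ℝ) ^ a / a.factorial ≤ Real.exp a := Real.pow_div_factorial_le_exp _ ha'.le a
  have h3 : (Real.exp 1) ^ a = Real.exp a := by rw [← Real.exp_nat_mul, mul_one]
  have hf : (0 : ℝ) < a.factorial := by exact_mod_cast a.factorial_pos
  have hp : (0 : ℝ) < (a : ℝ) ^ a := by positivity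
  refine h1.trans ?_
  rw [div_pow, mul_pow, h3, div_le_div_iff₀ hf hp]
  rw [div_le_iff₀ hf] at h2
  have : (0 : ℝ) ≤ (n : ℝ) ^ a := by positivity
  nlinarith

lemma sum_pow_le {r : ℝ} (h0 : 0 ≤ r) (h1 : r ≤ 1 / 2) (N : ℕ) :
    ∑ z ∈ Finset.range N, (if 1 ≤ z then r ^ z else 0) ≤ 2 * r := by
  suffices h : ∑ z ∈ Finset.range N, (if 1 ≤ z then r ^ z else 0) + 2 * (if N = 0 then r else r ^ N) ≤ 2 * r by
    have : 0 ≤ 2 * (if N = 0 then r else r ^ N) := by positivity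
    linarith
  induction N with
  | zero => simp
  | succ N ih =>
    rw [Finset.sum_range_succ]
    rcases Nat.eq_zero_or_pos N with rfl | hN
    · simp
    · simp only [hN.ne', if_false] at ih
      simp only [Nat.succ_le_of_lt hN, if_true, Nat.succ_ne_zero, if_false, pow_succ]
      have : 0 ≤ r ^ N := by positivity
      nlinarith

/-- A union bound over the nonempty vertex sets, grouped by size. -/
lemma prob_exists_finset_le {α : Type*} [Fintype α] [DecidableEq α] {p : ℝ} (h0 : 0 ≤ p)
    (h1 : p ≤ 1) {n : ℕ}
    (good : ℕ → Prop) (P : Finset (Fin n) → (α → Bool) → Prop) (g : ℕ → ℝ)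
    (hP : ∀ Z : Finset (Fin n), 1 ≤ Z.card → good Z.card → prob p (P Z) ≤ g Z.card)
    {r : ℝ} (hr0 : 0 ≤ r) (hr : r ≤ 1 / 2)
    (hg : ∀ z, 1 ≤ z → good z → (n.choose z : ℝ) * g z ≤ r ^ z) :
    prob p (fun ω => ∃ Z : Finset (Fin n), 1 ≤ Z.card ∧ good Z.card ∧ P Z ω) ≤ 2 * r := by
  calc _ ≤ prob p (fun ω => ∃ Z ∈ Finset.univ.filter
        (fun Z : Finset (Fin n) => 1 ≤ Z.card ∧ good Z.card), P Z ω) :=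
        prob_mono h0 h1 fun ω ⟨Z, hZ, hZ', h⟩ => ⟨Z, by simp [hZ, hZ', -Finset.one_le_card], h⟩
    _ ≤ ∑ Z ∈ Finset.univ.filter
        (fun Z : Finset (Fin n) => 1 ≤ Z.card ∧ good Z.card), prob p (P Z) :=
        prob_exists_le h0 h1 _ _
    _ ≤ ∑ Z ∈ Finset.univ.filter
        (fun Z : Finset (Fin n) => 1 ≤ Z.card ∧ good Z.card), g Z.card :=
        Finset.sum_le_sum fun Z hZ => by
          obtain ⟨hZ1, hZ2⟩ := (Finset.mem_filter.mp hZ).2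
          exact hP Z hZ1 hZ2
    _ = ∑ Z ∈ (Finset.univ : Finset (Fin n)).powerset,
        if 1 ≤ Z.card ∧ good Z.card then g Z.card else 0 := by
        rw [Finset.powerset_univ, Finset.sum_filter]
    _ = ∑ z ∈ Finset.range (n + 1), n.choose z •
        (if 1 ≤ z ∧ good z then g z else 0) := by
        rw [Finset.sum_powerset_apply_card (fun z => if 1 ≤ z ∧ good z then g z else 0)]
        simp
    _ ≤ ∑ z ∈ Finset.range (n + 1), (if 1 ≤ z then r ^ z else 0) := by
        refine Finset.sum_le_sum fun z _ => ?_
        by_cases hz : 1 ≤ z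
        · by_cases hz' : good z
          · simpa [hz, hz'] using hg z hz hz'
          · simp only [hz, hz', and_false, if_false, if_true, smul_zero]
            positivity
        · simp [hz]
    _ ≤ _ := sum_pow_le hr0 hr _

variable {k n : ℕ} {H : SimpleGraph (Fin k)} {p lam : ℝ}

lemma prob_dense_le (hiso : ∀ v, (H.neighborSet v).Nonempty) (hk : 0 < k)
    (h0 : 0 ≤ p) (h1 : p ≤ 1) (hlam : mr H n 1 * p = lam) (hn : 2 ≤ n) {s : ℝ} (hs : 0 ≤ s)
    (hr : Real.exp 1 ^ 3 * k ^ 2 * lam ^ 2 * s / n ≤ 1 / 2) :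
    prob p (fun ω : Copy H n → Bool => ∃ Z : Finset (Fin n), 1 ≤ Z.card ∧ (Z.card : ℝ) ≤ s ∧
      2 * Z.card ≤ (sel ω (copiesTwo H Z)).card) ≤
      2 * (Real.exp 1 ^ 3 * k ^ 2 * lam ^ 2 * s / n) := by
  have hn0 : (2 : ℝ) ≤ n := by exact_mod_cast hn
  have hlam0 : 0 ≤ lam := by rw [← hlam]; positivity
  refine prob_exists_finset_le h0 h1 (fun z => (z : ℝ) ≤ s) _
    (fun z => (Real.exp 1 * z * k * lam / n) ^ (2 * z)) ?_ (by positivity) hr ?_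
  · intro Z hZ _
    have hZ0 : (1 : ℝ) ≤ Z.card := by exact_mod_cast hZ
    have hc : ((n : ℝ) - 1) * (copiesTwo H Z).card ≤ Z.card ^ 2 * ((k - 1) * mr H n 1) := by
      have : (((n - 1 : ℕ) : ℝ)) * (copiesTwo H Z).card ≤
          Z.card ^ 2 * (((k - 1 : ℕ) : ℝ) * mr H n 1) := by
        exact_mod_cast card_copies_two_le (H := H) hiso Z
      rwa [Nat.cast_sub (by omega), Nat.cast_sub hk, Nat.cast_one] at this
    have hx : (copiesTwo H Z).card * p ≤ 2 * Z.card ^ 2 * k * lam / n := by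
      rw [le_div_iff₀ (by linarith)]
      have h2 : ((n : ℝ) - 1) * ((copiesTwo H Z).card * p) ≤ Z.card ^ 2 * (k - 1) * lam := by
        rw [← hlam]
        have := mul_le_mul_of_nonneg_right hc h0
        linarith
      have h3 : 0 ≤ ((copiesTwo H Z).card : ℝ) * p := by positivity
      have h4 : 0 ≤ (Z.card : ℝ) ^ 2 * lam := by positivity
      nlinarith
    refine (prob_many_le h0 h1 (copiesTwo H Z) (2 * Z.card) hx).trans_eq ?_
    congr 1
    push_cast
    field_simp
  · intro z hz hzs
    have hz0 : (1 : ℝ) ≤ z := by exact_mod_cast hz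
    calc (n.choose z : ℝ) * (Real.exp 1 * z * k * lam / n) ^ (2 * z)
        ≤ (Real.exp 1 * n / z) ^ z * ((Real.exp 1 * z * k * lam / n) ^ 2) ^ z := by
          rw [pow_mul]
          gcongr
          exact choose_le_exp_mul_div_pow n z hz
      _ = (Real.exp 1 ^ 3 * k ^ 2 * lam ^ 2 * z / n) ^ z := by
          rw [← mul_pow]
          congr 1
          field_simp
      _ ≤ _ := by gcongr

lemma prob_no_edge_le (hiso : ∀ v, (H.neighborSet v).Nonempty) (hk : 0 < k)
    (h0 : 0 ≤ p) (h1 : p ≤ 1) (hlam : mr H n 1 * p = lam) (hn : 2 ≤ n)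
    {A B : Finset (Fin n)} (hAB : Disjoint A B) :
    prob p (fun ω : Copy H n → Bool => ∀ c ∈ copiesBetween H A B, ω c = false) ≤
      Real.exp (-(A.card * B.card * lam / (n * k ^ 2))) := by
  refine (prob_none_le h1 _).trans (Real.exp_le_exp.mpr (neg_le_neg ?_))
  have hn0 : (2 : ℝ) ≤ n := by exact_mod_cast hn
  have hk0 : (0 : ℝ) < k := by exact_mod_cast hk
  have hc : (A.card : ℝ) * B.card * mr H n 1 ≤ (n - 1) * (k ^ 2 * (copiesBetween H A B).card) := by
    have : (A.card : ℝ) * B.card * mr H n 1 ≤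
        ((n - 1 : ℕ) : ℝ) * (k ^ 2 * (copiesBetween H A B).card) := by
      exact_mod_cast le_card_copies_between (H := H) hiso hAB
    rwa [Nat.cast_sub (by omega), Nat.cast_one] at this
  rw [div_le_iff₀ (by positivity), ← hlam]
  have h2 := mul_le_mul_of_nonneg_right hc h0
  have h3 : 0 ≤ (k : ℝ) ^ 2 * (copiesBetween H A B).card * p := by positivity
  nlinarith

lemma prob_small_neighborhood_le (hiso : ∀ v, (H.neighborSet v).Nonempty) (hk : 0 < k)
    (h0 : 0 ≤ p) (h1 : p ≤ 1) (hlam : mr H n 1 * p = lam) (hn : 2 ≤ n) {θ : ℝ} (hθ : 0 < θ)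
    (hr : (Real.exp 1 * n / θ) ^ 2 * Real.exp (-(lam / (2 * k ^ 2))) ≤ 1 / 2) :
    prob p (fun ω : Copy H n → Bool => ∃ A : Finset (Fin n), 1 ≤ A.card ∧
      (θ ≤ (A.card : ℝ) ∧ 4 * (A.card : ℝ) ≤ n) ∧ ∃ W : Finset (Fin n), W.card = A.card ∧
        ∀ c ∈ copiesBetween H A (A ∪ W)ᶜ, ω c = false) ≤
      2 * ((Real.exp 1 * n / θ) ^ 2 * Real.exp (-(lam / (2 * k ^ 2)))) := by
  have hn0 : (2 : ℝ) ≤ n := by exact_mod_cast hn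
  have hk0 : (0 : ℝ) < k := by exact_mod_cast hk
  have hlam0 : 0 ≤ lam := by rw [← hlam]; positivity
  refine prob_exists_finset_le h0 h1 (fun z => θ ≤ (z : ℝ) ∧ 4 * (z : ℝ) ≤ n)
    (fun A ω => ∃ W : Finset (Fin n), W.card = A.card ∧
        ∀ c ∈ copiesBetween H A (A ∪ W)ᶜ, ω c = false)
    (fun z => n.choose z * Real.exp (-(lam / (2 * k ^ 2))) ^ z) ?_ (by positivity) hr ?_
  · rintro A hA ⟨-, hA4⟩
    calc _ ≤ prob p (fun ω : Copy H n → Bool => ∃ W ∈ Finset.univ.powersetCard A.card,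
          ∀ c ∈ copiesBetween H A (A ∪ W)ᶜ, ω c = false) :=
          prob_mono h0 h1 fun ω ⟨W, hW, h⟩ => ⟨W, by simp [hW], h⟩
      _ ≤ ∑ W ∈ (Finset.univ : Finset (Fin n)).powersetCard A.card,
          prob p (fun ω : Copy H n → Bool => ∀ c ∈ copiesBetween H A (A ∪ W)ᶜ, ω c = false) :=
          prob_exists_le h0 h1 _ _
      _ ≤ ∑ W ∈ (Finset.univ : Finset (Fin n)).powersetCard A.card,
          Real.exp (-(lam / (2 * k ^ 2))) ^ A.card := by
          refine Finset.sum_le_sum fun W hW => ?_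
          have hWc : W.card = A.card := (Finset.mem_powersetCard.mp hW).2
          refine (prob_no_edge_le hiso hk h0 h1 hlam hn ?_).trans ?_
          · exact Finset.disjoint_of_subset_left Finset.subset_union_left disjoint_compl_right
          rw [← Real.exp_nat_mul, Real.exp_le_exp, mul_neg, neg_le_neg_iff]
          have hB : (n : ℝ) ≤ 2 * ((A ∪ W)ᶜ.card : ℝ) := by
            have h3 := Finset.card_add_card_compl (A ∪ W)
            have h4 := Finset.card_union_le A W
            rw [Fintype.card_fin] at h3
            have h5 : 4 * A.card ≤ n := by exact_mod_cast hA4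
            have : n ≤ 2 * (A ∪ W)ᶜ.card := by omega
            exact_mod_cast this
          rw [le_div_iff₀ (by positivity)]
          calc (A.card : ℝ) * (lam / (2 * k ^ 2)) * (n * k ^ 2) = A.card * lam * n / 2 := by
                field_simp
            _ ≤ A.card * lam * (2 * ((A ∪ W)ᶜ.card : ℝ)) / 2 := by gcongr
            _ = _ := by ring
      _ = _ := by simp
  · rintro z hz ⟨hzθ, -⟩
    have hz0 : (1 : ℝ) ≤ z := by exact_mod_cast hz
    calc (n.choose z : ℝ) * (n.choose z * Real.exp (-(lam / (2 * k ^ 2))) ^ z)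
        ≤ (Real.exp 1 * n / z) ^ z * ((Real.exp 1 * n / z) ^ z *
          Real.exp (-(lam / (2 * k ^ 2))) ^ z) := by
          have := choose_le_exp_mul_div_pow n z hz
          gcongr
      _ = ((Real.exp 1 * n / z) ^ 2 * Real.exp (-(lam / (2 * k ^ 2)))) ^ z := by
          rw [mul_pow, ← pow_mul, mul_comm 2 z, pow_mul, sq (_ ^ z), mul_assoc]
      _ ≤ _ := by gcongr

lemma prob_large_no_edge_le (hiso : ∀ v, (H.neighborSet v).Nonempty) (hk : 0 < k)
    (h0 : 0 ≤ p) (h1 : p ≤ 1) (hlam : mr H n 1 * p = lam) (hn : 2 ≤ n) :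
    prob p (fun ω : Copy H n → Bool => ∃ A B : Finset (Fin n), Disjoint A B ∧
      (n : ℝ) ≤ 8 * A.card ∧ (n : ℝ) ≤ 8 * B.card ∧
        ∀ c ∈ copiesBetween H A B, ω c = false) ≤
      4 ^ n * Real.exp (-(n * lam / (64 * k ^ 2))) := by
  have hn0 : (2 : ℝ) ≤ n := by exact_mod_cast hn
  have hk0 : (0 : ℝ) < k := by exact_mod_cast hk
  have hlam0 : 0 ≤ lam := by rw [← hlam]; positivity
  calc _ ≤ prob p (fun ω : Copy H n → Bool => ∃ x ∈ Finset.univ.filter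
        (fun x : Finset (Fin n) × Finset (Fin n) => Disjoint x.1 x.2 ∧
          (n : ℝ) ≤ 8 * x.1.card ∧ (n : ℝ) ≤ 8 * x.2.card),
        ∀ c ∈ copiesBetween H x.1 x.2, ω c = false) :=
        prob_mono h0 h1 fun ω ⟨A, B, hd, hA, hB, h⟩ => ⟨(A, B), by simp [hd, hA, hB], h⟩
    _ ≤ _ := prob_exists_le h0 h1 _ _
    _ ≤ ∑ x ∈ Finset.univ.filter
        (fun x : Finset (Fin n) × Finset (Fin n) => Disjoint x.1 x.2 ∧
          (n : ℝ) ≤ 8 * x.1.card ∧ (n : ℝ) ≤ 8 * x.2.card),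
        Real.exp (-(n * lam / (64 * k ^ 2))) := by
        refine Finset.sum_le_sum fun x hx => ?_
        obtain ⟨hd, hA, hB⟩ := (Finset.mem_filter.mp hx).2
        refine (prob_no_edge_le hiso hk h0 h1 hlam hn hd).trans
          (Real.exp_le_exp.mpr (neg_le_neg ?_))
        rw [div_le_div_iff₀ (by positivity) (by positivity)]
        have : (n : ℝ) * n ≤ (8 * x.1.card) * (8 * x.2.card) := by gcongr
        have h3 : 0 ≤ lam * (k : ℝ) ^ 2 := by positivity
        nlinarith
    _ ≤ ∑ x : Finset (Fin n) × Finset (Fin n), Real.exp (-(n * lam / (64 * k ^ 2))) :=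
        Finset.sum_le_sum_of_subset_of_nonneg (Finset.filter_subset _ _)
          fun _ _ _ => (Real.exp_pos _).le
    _ = _ := by
        simp only [Finset.sum_const, Finset.card_univ, Fintype.card_prod, Fintype.card_finset,
          Fintype.card_fin, nsmul_eq_mul, ← mul_pow]
        norm_num

end Unions

section Assembly

open Classical

variable {k n : ℕ} {H : SimpleGraph (Fin k)}

lemma exists_adj_of_sel {ω : Copy H n → Bool} {v : Fin n} {c : Copy H n} (hc : c ∈ copiesAt H v)
    (hω : ω c = true) : ∃ w, c.1.Adj v w ∧ (graphOf ω).Adj v w := by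
  obtain ⟨w, hw⟩ := Copy.mem_verts.mp (mem_copiesAt.mp hc)
  exact ⟨w, hw, graphOf_adj.mpr ⟨c, hω, hw⟩⟩

/-- Vertices in many selected copies expand, unless some small set is too dense. -/
lemma four_mul_card_le_outerNbr (hiso : ∀ v, (H.neighborSet v).Nonempty) (hk : 0 < k)
    (ω : Copy H n → Bool) (U : Finset (Fin n))
    (hU : ∀ v ∈ U, 10 * k ≤ (sel ω (copiesAt H v)).card)
    (hdense : ∀ Z : Finset (Fin n), 1 ≤ Z.card → Z.card ≤ 5 * U.card →
      (sel ω (copiesTwo H Z)).card < 2 * Z.card) :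
    4 * U.card ≤ (outerNbr (graphOf ω) U).card := by
  by_contra! hlt
  set Z := U ∪ outerNbr (graphOf ω) U with hZ
  have hZ5 : Z.card ≤ 5 * U.card := (Finset.card_union_le _ _).trans (by omega)
  have hUZ : U.card ≤ Z.card := Finset.card_le_card Finset.subset_union_left
  have hd := hdense Z (by omega) hZ5
  set T := sel ω (copiesTwo H Z) with hT
  have h1 := Finset.sum_card_bipartiteAbove_eq_sum_card_bipartiteBelow
    (s := U) (t := T) (fun v c => v ∈ c.verts)
  have h2 : ∀ v ∈ U, 10 * k ≤ (T.bipartiteAbove (fun v c => v ∈ c.verts) v).card := by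
    intro v hv
    refine (hU v hv).trans (Finset.card_le_card fun c hc => ?_)
    obtain ⟨hc, hω⟩ := mem_sel.mp hc
    obtain ⟨w, hcw, hw⟩ := exists_adj_of_sel hc hω
    have hwZ : w ∈ Z := by
      by_cases hwU : w ∈ U
      · exact Finset.mem_union_left _ hwU
      · exact Finset.mem_union_right _ (mem_outerNbr.mpr ⟨hwU, v, hv, hw⟩)
    have hvc := mem_copiesAt.mp hc
    refine Finset.mem_filter.mpr ⟨mem_sel.mpr ⟨Finset.mem_filter.mpr ⟨Finset.mem_univ _, v,
      Finset.mem_union_left _ hv, w, hwZ, hw.ne, hvc, Copy.mem_verts.mpr ⟨v, hcw.symm⟩⟩, hω⟩, hvc⟩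
  have h3 : ∀ c ∈ T, (U.bipartiteBelow (fun v (c : Copy H n) => v ∈ c.verts) c).card ≤ k := by
    intro c _
    exact (Finset.card_le_card fun v hv => (Finset.mem_filter.mp hv).2).trans_eq
      (Copy.card_verts hiso c)
  have h4 := Finset.sum_le_sum h2
  have h5 := Finset.sum_le_sum h3
  rw [Finset.sum_const, smul_eq_mul] at h4 h5
  have h6 : (10 * U.card) * k ≤ T.card * k := by
    rw [← h1] at h5
    linarith
  have := Nat.le_of_mul_le_mul_right h6 hk
  omega

lemma exists_isPerfectMatching_graphOf (hiso : ∀ v, (H.neighborSet v).Nonempty) (hk : 0 < k)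
    (hn : 2 ≤ n) (heven : Even n) (ω : Copy H n → Bool) {θ : ℝ}
    (hiso' : ¬ ∃ v, ∀ c ∈ copiesAt H v, ω c = false)
    (hfar : ¬ ∃ v w, v ≠ w ∧
      ((sel ω (copiesAt H v)).card < 10 * k ∧ (sel ω (copiesAt H w)).card < 10 * k) ∧
        Close (graphOf ω) v w)
    (hdense : ¬ ∃ Z : Finset (Fin n), 1 ≤ Z.card ∧ (Z.card : ℝ) ≤ 5 * θ ∧
      2 * Z.card ≤ (sel ω (copiesTwo H Z)).card)
    (hmid : ¬ ∃ A : Finset (Fin n), 1 ≤ A.card ∧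
      (θ ≤ (A.card : ℝ) ∧ 4 * (A.card : ℝ) ≤ n) ∧ ∃ W : Finset (Fin n), W.card = A.card ∧
        ∀ c ∈ copiesBetween H A (A ∪ W)ᶜ, ω c = false)
    (hlarge : ¬ ∃ A B : Finset (Fin n), Disjoint A B ∧
      (n : ℝ) ≤ 8 * A.card ∧ (n : ℝ) ≤ 8 * B.card ∧
        ∀ c ∈ copiesBetween H A B, ω c = false) :
    ∃ M : (graphOf ω).Subgraph, M.IsPerfectMatching := by
  have hn0 : (2 : ℝ) ≤ n := by exact_mod_cast hn
  have hadj : ∀ A B : Finset (Fin n), ¬ (∀ c ∈ copiesBetween H A B, ω c = false) →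
      ∃ v ∈ A, ∃ w ∈ B, (graphOf ω).Adj v w := by
    intro A B h
    push Not at h
    obtain ⟨c, hc, hω⟩ := h
    obtain ⟨v, hv, w, hw, hvw⟩ := (Finset.mem_filter.mp hc).2
    exact ⟨v, hv, w, hw, graphOf_adj.mpr ⟨c, by simpa using hω, hvw⟩⟩
  refine exists_isPerfectMatching_of_expansion (graphOf ω) (by simpa using heven) (n / 8)
    (by linarith) (by rw [Fintype.card_fin]; linarith) ?_ ?_
  · intro U hU
    by_cases hUθ : (U.card : ℝ) ≤ θ
    · refine card_le_card_outerNbr (graphOf ω) (fun v => (sel ω (copiesAt H v)).card < 10 * k) θ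
        ?_ ?_ ?_ U hUθ
      · intro v
        by_contra hv
        refine hiso' ⟨v, fun c hc => ?_⟩
        by_contra hω
        obtain ⟨w, -, hw⟩ := exists_adj_of_sel hc (by simpa using hω)
        exact hv ⟨w, hw⟩
      · intro v w hne hv hw hc
        exact hfar ⟨v, w, hne, ⟨hv, hw⟩, hc⟩
      · intro U' hU' hU'θ
        refine four_mul_card_le_outerNbr hiso hk ω U' (fun v hv => not_lt.mp (hU' v hv)) ?_
        intro Z hZ hZU
        by_contra hZ2
        refine hdense ⟨Z, hZ, ?_, not_lt.mp hZ2⟩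
        have : (Z.card : ℝ) ≤ 5 * U'.card := by exact_mod_cast hZU
        linarith
    · by_contra! hlt
      obtain ⟨W, hNW, hW⟩ := Finset.exists_superset_card_eq hlt.le
        (by rw [Fintype.card_fin]; exact (Finset.card_le_univ U).trans_eq (Fintype.card_fin n))
      have hU1 : 1 ≤ U.card := by omega
      refine hmid ⟨U, hU1, ⟨by linarith, by linarith⟩, W, hW, ?_⟩
      by_contra h
      obtain ⟨v, hv, w, hw, hvw⟩ := hadj _ _ h
      rw [Finset.mem_compl, Finset.mem_union, not_or] at hw
      exact hw.2 (hNW (mem_outerNbr.mpr ⟨hw.1, v, hv, hvw⟩))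
  · intro A B hAB hA hB
    refine hadj A B fun h => hlarge ⟨A, B, hAB, by linarith, by linarith, h⟩

lemma not_isPerfectMatching_of_isolated (ω : Copy H n → Bool) {v : Fin n}
    (hv : ∀ c ∈ copiesAt H v, ω c = false) :
    ¬ ∃ M : (graphOf ω).Subgraph, M.IsPerfectMatching := by
  rintro ⟨M, hM⟩
  obtain ⟨w, hw, -⟩ := hM.1 (hM.2 v)
  obtain ⟨c, hc, hadj⟩ := graphOf_adj.mp hw.adj_sub
  have := hv c (mem_copiesAt.mpr (Copy.mem_verts.mpr ⟨w, hadj⟩))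
  simp [hc] at this

lemma isPerfectMatching_mono {V : Type*} {G G' : SimpleGraph V} (h : G ≤ G')
    (hG : ∃ M : G.Subgraph, M.IsPerfectMatching) : ∃ M : G'.Subgraph, M.IsPerfectMatching := by
  obtain ⟨M, hM⟩ := hG
  refine ⟨⟨M.verts, M.Adj, fun hvw => h hvw.adj_sub, fun hvw => M.edge_vert hvw, M.symm⟩, ?_, ?_⟩
  · exact hM.1
  · exact hM.2

variable {p lam : ℝ}

/-- The probability that there is no perfect matching. -/
lemma prob_not_perfect_matching_le (hiso : ∀ v, (H.neighborSet v).Nonempty) (hk : 0 < k)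
    (h0 : 0 ≤ p) (h1 : p ≤ 1) (hlam : mr H n 1 * p = lam) (hn : 2 ≤ n) (heven : Even n)
    (hsmall : lam * k ≤ n - 1) (hlam1 : 1 ≤ lam) (t : ℕ) {θ : ℝ} (hθ : 0 < θ)
    (hr : Real.exp 1 ^ 3 * k ^ 2 * lam ^ 2 * (5 * θ) / n ≤ 1 / 2)
    (hr' : (Real.exp 1 * n / θ) ^ 2 * Real.exp (-(lam / (2 * k ^ 2))) ≤ 1 / 2) :
    prob p (fun ω : Copy H n → Bool => ¬ ∃ M : (graphOf ω).Subgraph, M.IsPerfectMatching) ≤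
      n * Real.exp (-lam) +
      ((2 * (10 * k) : ℕ) * ((2 * lam) ^ (2 * (10 * k)) * Real.exp (2 * (10 * k) : ℕ) *
          Real.exp (1 - 2 * lam)) *
        (n * (1 + k * t) ^ 4 + n ^ 2 * (n * (Real.exp 1 * lam / t) ^ t)) +
      (2 * (Real.exp 1 ^ 3 * k ^ 2 * lam ^ 2 * (5 * θ) / n) +
      (2 * ((Real.exp 1 * n / θ) ^ 2 * Real.exp (-(lam / (2 * k ^ 2)))) +
      4 ^ n * Real.exp (-(n * lam / (64 * k ^ 2)))))) := by
  refine (prob_mono h0 h1 (Q := fun ω => _ ∨ _ ∨ _ ∨ _ ∨ _) fun ω h => ?_).trans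
    ((prob_or_le h0 h1 _ _).trans (add_le_add (prob_isolated_le h0 h1 hlam)
    ((prob_or_le h0 h1 _ _).trans (add_le_add
      (prob_low_close_le hiso hk h0 h1 hlam hn hsmall hlam1 (10 * k) t)
    ((prob_or_le h0 h1 _ _).trans (add_le_add
      (prob_dense_le hiso hk h0 h1 hlam hn (by positivity) hr)
    ((prob_or_le h0 h1 _ _).trans (add_le_add
      (prob_small_neighborhood_le hiso hk h0 h1 hlam hn hθ hr')
      (prob_large_no_edge_le hiso hk h0 h1 hlam hn)))))))))
  by_contra hcon
  simp only [not_or] at hcon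
  obtain ⟨a, b, c, d, e⟩ := hcon
  exact h (exists_isPerfectMatching_graphOf hiso hk hn heven ω a b c d e)

end Assembly

section LowerBound

open Classical

variable {k n : ℕ} {H : SimpleGraph (Fin k)} {p : ℝ}

lemma exp_le_one_sub (h0 : 0 ≤ p) (h1 : p ≤ 1 / 2) : Real.exp (-(p + p ^ 2)) ≤ 1 - p := by
  have h := Real.quadratic_le_exp_of_nonneg (x := p + p ^ 2) (by positivity)
  rw [Real.exp_neg, inv_le_comm₀ (Real.exp_pos _) (by linarith), inv_le_iff_one_le_mul₀ (by linarith)]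
  have h2 : 1 ≤ (1 + (p + p ^ 2) + (p + p ^ 2) ^ 2 / 2) * (1 - p) := by
    have h3 : 0 ≤ 1 - p - p ^ 2 - p ^ 3 := by
      have : p ^ 2 ≤ (1 / 2) ^ 2 := by gcongr
      have : p ^ 3 ≤ (1 / 2) ^ 3 := by gcongr
      norm_num at *
      linarith
    nlinarith [mul_nonneg (sq_nonneg p) h3]
  exact h2.trans (mul_le_mul_of_nonneg_right h (by linarith))

/-- The second moment bound for isolated vertices. -/
lemma prob_no_isolated_le (hiso : ∀ v, (H.neighborSet v).Nonempty) (hk : 0 < k)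
    (h0 : 0 ≤ p) (h1 : p ≤ 1 / 2) (hn : 2 ≤ n) {l : ℝ} (hl : mr H n 1 * p ≤ l) :
    prob p (fun ω : Copy H n → Bool => ∀ v, ¬ ∀ c ∈ copiesAt H v, ω c = false) ≤
      1 / (n * (1 - p) ^ mr H n 1) + Real.exp (2 * (k * l / (n - 1))) - 1 := by
  have hn0 : (2 : ℝ) ≤ n := by exact_mod_cast hn
  have hl0 : 0 ≤ l := le_trans (by positivity) hl
  set q := 1 - p with hq
  have hq0 : 0 < q := by linarith
  set E := Real.exp (2 * (k * l / (n - 1))) with hE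
  set N := mr H n 1 with hN
  have hsingle : ∀ v : Fin n, prob p (fun ω : Copy H n → Bool => ∀ c ∈ copiesAt H v, ω c = false) =
      q ^ N := fun v => by rw [prob_none, card_copiesAt]
  have hpair : ∀ v w : Fin n, v ≠ w → prob p (fun ω : Copy H n → Bool =>
      (∀ c ∈ copiesAt H v, ω c = false) ∧ ∀ c ∈ copiesAt H w, ω c = false) ≤
      (q ^ N) ^ 2 * E := by
    intro v w hvw
    have e1 : prob p (fun ω : Copy H n → Bool =>
        (∀ c ∈ copiesAt H v, ω c = false) ∧ ∀ c ∈ copiesAt H w, ω c = false) =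
        q ^ (copiesAt H v ∪ copiesAt H w).card := by
      rw [← prob_none p]
      congr 1
      funext ω
      simp only [Finset.mem_union, or_imp, forall_and]
    have e2 : (n - 1) * (copiesAt₂ H v w).card = (k - 1) * N := card_copiesAt₂ hiso hvw
    have e3 : ((n : ℝ) - 1) * (copiesAt₂ H v w).card = (k - 1) * N := by
      have : ((n - 1 : ℕ) : ℝ) * (copiesAt₂ H v w).card = ((k - 1 : ℕ) : ℝ) * N := by
        exact_mod_cast e2
      rwa [Nat.cast_sub (by omega), Nat.cast_sub hk, Nat.cast_one] at this
    have e4 : p * (copiesAt₂ H v w).card ≤ k * l / (n - 1) := by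
      rw [le_div_iff₀ (by linarith)]
      have h3 : 0 ≤ (N : ℝ) * p := by positivity
      have h4 : (k : ℝ) * (N * p) ≤ k * l := by gcongr
      calc p * (copiesAt₂ H v w).card * ((n : ℝ) - 1) = (k - 1) * N * p := by rw [← e3]; ring
        _ ≤ _ := by linarith
    have e5 : 1 ≤ q ^ (copiesAt₂ H v w).card * E := by
      have h5 : Real.exp (-(2 * p)) ≤ q := by
        refine le_trans (Real.exp_le_exp.mpr ?_) (exp_le_one_sub h0 h1)
        nlinarith
      calc (1 : ℝ) = Real.exp (-(2 * p)) ^ (copiesAt₂ H v w).card *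
            Real.exp (2 * (p * (copiesAt₂ H v w).card)) := by
            rw [← Real.exp_nat_mul, ← Real.exp_add, eq_comm, Real.exp_eq_one_iff]
            ring
        _ ≤ _ := by
            gcongr
            exact Real.exp_le_exp.mpr (mul_le_mul_of_nonneg_left e4 zero_le_two)
    have e6 := card_copiesAt_union (H := H) v w
    rw [e1]
    calc q ^ (copiesAt H v ∪ copiesAt H w).card
        ≤ q ^ (copiesAt H v ∪ copiesAt H w).card * (q ^ (copiesAt₂ H v w).card * E) :=
          le_mul_of_one_le_right (by positivity) e5
      _ = _ := by rw [← mul_assoc, ← pow_add, e6, mul_comm 2, pow_mul]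
  have hμ : ∑ v : Fin n, prob p (fun ω : Copy H n → Bool => ∀ c ∈ copiesAt H v, ω c = false) =
      n * q ^ N := by
    rw [Finset.sum_congr rfl fun v _ => hsingle v]
    simp
  have hqN : 0 < q ^ N := by positivity
  have hμ0 : 0 < n * q ^ N := by positivity
  have h := prob_none_le_of_second_moment h0 (by linarith) (Finset.univ : Finset (Fin n))
    (fun v (ω : Copy H n → Bool) => ∀ c ∈ copiesAt H v, ω c = false) (by rwa [hμ])
  rw [hμ] at h
  calc _ = prob p (fun ω : Copy H n → Bool =>
        ∀ v ∈ Finset.univ, ¬ ∀ c ∈ copiesAt H v, ω c = false) := by simp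
    _ ≤ _ := h
    _ ≤ (∑ v : Fin n, (q ^ N + n * ((q ^ N) ^ 2 * E))) / (n * q ^ N) ^ 2 - 1 := by
        gcongr with v _
        calc _ ≤ ∑ w : Fin n, ((if v = w then q ^ N else 0) + (q ^ N) ^ 2 * E) := by
              refine Finset.sum_le_sum fun w _ => ?_
              by_cases hvw : v = w
              · subst hvw
                simp only [and_self, if_true, hsingle]
                have : 0 ≤ (q ^ N) ^ 2 * E := by positivity
                linarith
              · simpa [hvw] using hpair v w hvw
          _ = _ := by rw [Finset.sum_add_distrib]; simp
    _ = _ := by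
        rw [Finset.sum_const, Finset.card_univ, Fintype.card_fin, nsmul_eq_mul]
        field_simp

end LowerBound

section Asymptotics

variable {x : ℕ → ℝ}

lemma tendsto_log_nat : Tendsto (fun n : ℕ => Real.log n) atTop atTop :=
  Real.tendsto_log_atTop.comp tendsto_natCast_atTop_atTop

lemma eventually_bounds (hx : Tendsto x atTop atTop)
    (hx' : Tendsto (fun n => x n / Real.log (Real.log n)) atTop (nhds 0)) :
    ∀ᶠ n : ℕ in atTop, 0 ≤ x n ∧ x n ≤ Real.log n := by
  have h1 := (Real.tendsto_log_atTop.comp tendsto_log_nat).eventually_gt_atTop 0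
  filter_upwards [hx.eventually_ge_atTop 0, hx'.eventually_lt_const one_pos, h1,
    tendsto_log_nat.eventually_ge_atTop 0] with n h2 h3 h4 h5
  simp only [Function.comp] at h4
  rw [div_lt_one h4] at h3
  exact ⟨h2, h3.le.trans (Real.log_le_self h5)⟩

lemma tendsto_log_pow_div (j : ℕ) :
    Tendsto (fun n : ℕ => Real.log n ^ j / (n - 1)) atTop (nhds 0) := by
  have h := ((Real.tendsto_pow_mul_exp_neg_atTop_nhds_zero j).comp tendsto_log_nat).const_mul 2
  rw [mul_zero] at h
  refine squeeze_zero' ?_ ?_ h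
  · filter_upwards [eventually_ge_atTop 2] with n hn
    have hn0 : (2 : ℝ) ≤ n := by exact_mod_cast hn
    have := Real.log_natCast_nonneg n
    exact div_nonneg (by positivity) (by linarith)
  · filter_upwards [eventually_ge_atTop 2] with n hn
    have hn0 : (2 : ℝ) ≤ n := by exact_mod_cast hn
    have := Real.log_natCast_nonneg n
    simp only [Function.comp]
    rw [Real.exp_neg, Real.exp_log (by linarith), div_le_iff₀ (by linarith)]
    have h3 : 0 ≤ Real.log n ^ j := by positivity
    have h4 : (1 : ℝ) ≤ 2 * (n : ℝ)⁻¹ * (n - 1) := by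
      field_simp
      linarith
    nlinarith

end Asymptotics

section Main

open Classical

variable {k : ℕ} {H : SimpleGraph (Fin k)} {x : ℕ → ℝ}

lemma deltad_one_eq_zero (hk : 0 < k) (hiso : ∀ v, (H.neighborSet v).Nonempty) :
    deltad H 1 = 0 := by
  have : Nonempty (Fin k) := ⟨⟨0, hk⟩⟩
  have h1 : 1 ≤ minDeg H :=
    le_ciInf fun v => Nat.succ_le_of_lt ((Set.ncard_pos (Set.toFinite _)).mpr (hiso v))
  have h2 : (1 : ℝ) / minDeg H ≤ 1 := by
    have : (1 : ℝ) ≤ minDeg H := by exact_mod_cast h1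
    rw [div_le_one (by linarith)]
    exact this
  have h3 : ⌈((1 : ℕ) : ℝ) / (minDeg H : ℝ)⌉₊ ≤ 1 := by
    rw [Nat.ceil_le]
    simpa using h2
  unfold deltad
  omega

lemma pMinus_eq (hk : 0 < k) (hiso : ∀ v, (H.neighborSet v).Nonempty) (n : ℕ) :
    pMinus H 1 x n = (Real.log n - x n) / mr H n 1 := by
  simp [pMinus, deltad_one_eq_zero hk hiso]

lemma pPlus_eq (hk : 0 < k) (hiso : ∀ v, (H.neighborSet v).Nonempty) (n : ℕ) :
    pPlus H 1 x n = (Real.log n + x n) / mr H n 1 := by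
  simp [pPlus, deltad_one_eq_zero hk hiso]

lemma le_mul_mr {n : ℕ} (hk : 0 < k) (hiso : ∀ v, (H.neighborSet v).Nonempty) (hkn : k ≤ n)
    (hn : 2 ≤ n) : (n : ℝ) - 1 ≤ k * mr H n 1 := by
  have h1 : ((n - 1 : ℕ) : ℝ) ≤ ((k - 1 : ℕ) : ℝ) * mr H n 1 := by
    exact_mod_cast le_mr (H := H) hk hiso hkn
  rw [Nat.cast_sub (by omega), Nat.cast_sub hk, Nat.cast_one] at h1
  have : (0 : ℝ) ≤ mr H n 1 := by positivity
  linarith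

lemma mr_pos {n : ℕ} (hk : 0 < k) (hiso : ∀ v, (H.neighborSet v).Nonempty) (hkn : k ≤ n)
    (hn : 2 ≤ n) : (0 : ℝ) < mr H n 1 := by
  have h1 := le_mul_mr (H := H) hk hiso hkn hn
  have hn0 : (2 : ℝ) ≤ n := by exact_mod_cast hn
  have hk0 : (0 : ℝ) < k := by exact_mod_cast hk
  by_contra! h
  nlinarith

/-- Below the threshold. -/
lemma motifProb_le {n : ℕ} (hk : 0 < k) (hiso : ∀ v, (H.neighborSet v).Nonempty) {p : ℝ}
    (h0 : 0 ≤ p) (hkn : k ≤ n) (hn : 2 ≤ n) (hx : 0 ≤ x n)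
    (hp : p ≤ pMinus H 1 x n) (h1 : k * (Real.log n / (n - 1)) ≤ 1 / 2)
    (h2 : k * (Real.log n ^ 2 / (n - 1)) ≤ 1) :
    motifProb H n p (fun G => ∃ M : G.Subgraph, M.IsPerfectMatching) ≤
      Real.exp (1 - x n) + Real.exp (2 * (k * (Real.log n / (n - 1)))) - 1 := by
  have hn0 : (2 : ℝ) ≤ n := by exact_mod_cast hn
  have hN := mr_pos (H := H) hk hiso hkn hn
  have hL := Real.log_natCast_nonneg n
  have hN' := le_mul_mr (H := H) hk hiso hkn hn
  rw [pMinus_eq hk hiso, le_div_iff₀ hN] at hp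
  set N := mr H n 1 with hNdef
  set L := Real.log n with hLdef
  have hpL : N * p ≤ L := by linarith
  have hpn : p * (n - 1) ≤ k * L := by
    have : p * (n - 1) ≤ p * (k * N) := by gcongr
    have hk0 : (0 : ℝ) ≤ k := by positivity
    nlinarith
  have hpn' : p ≤ k * (L / (n - 1)) := by
    rw [← mul_div_assoc, le_div_iff₀ (by linarith)]
    exact hpn
  have hp2 : p ≤ 1 / 2 := hpn'.trans h1
  have hpp : N * p ^ 2 ≤ 1 := by
    calc (N : ℝ) * p ^ 2 = (N * p) * p := by ring
      _ ≤ L * (k * (L / (n - 1))) := by gcongr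
      _ = k * (L ^ 2 / (n - 1)) := by ring
      _ ≤ 1 := h2
  have hEX : Real.exp (x n - 1) ≤ n * (1 - p) ^ N := by
    calc Real.exp (x n - 1) ≤ Real.exp (L + N * (-(p + p ^ 2))) :=
          Real.exp_le_exp.mpr (by nlinarith)
      _ = n * Real.exp (-(p + p ^ 2)) ^ N := by
          rw [Real.exp_add, hLdef, Real.exp_log (by linarith), Real.exp_nat_mul]
      _ ≤ _ := by
          gcongr
          exact exp_le_one_sub h0 hp2
  calc _ = prob p (fun ω : Copy H n → Bool => ∃ M : (graphOf ω).Subgraph, M.IsPerfectMatching) := rfl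
    _ ≤ prob p (fun ω : Copy H n → Bool => ∀ v, ¬ ∀ c ∈ copiesAt H v, ω c = false) :=
        prob_mono h0 (by linarith) fun ω h v hv => not_isPerfectMatching_of_isolated ω hv h
    _ ≤ _ := prob_no_isolated_le hiso hk h0 hp2 hn hpL
    _ ≤ _ := by
        have : 1 / (n * (1 - p) ^ N) ≤ Real.exp (1 - x n) := by
          rw [← neg_sub (x n) 1, Real.exp_neg, ← one_div]
          exact one_div_le_one_div_of_le (Real.exp_pos _) hEX
        rw [mul_div_assoc]
        linarith

lemma tendsto_motifProb_zero (hk : 0 < k) (hiso : ∀ v, (H.neighborSet v).Nonempty)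
    (hx : Tendsto x atTop atTop) {ι : Type*} {l : Filter ι} {N : ι → ℕ} (hN : Tendsto N l atTop)
    {p : ι → ℝ} (h0 : ∀ i, 0 ≤ p i) (h1 : ∀ i, p i ≤ 1)
    (hp : ∀ᶠ i in l, p i ≤ pMinus H 1 x (N i)) :
    Tendsto (fun i => motifProb H (N i) (p i)
      (fun G => ∃ M : G.Subgraph, M.IsPerfectMatching)) l (nhds 0) := by
  have e1 : Tendsto (fun n : ℕ => k * (Real.log n / (n - 1))) atTop (nhds 0) := by
    simpa using (tendsto_log_pow_div 1).const_mul (k : ℝ)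
  have e2 : Tendsto (fun n : ℕ => k * (Real.log n ^ 2 / (n - 1))) atTop (nhds 0) := by
    simpa using (tendsto_log_pow_div 2).const_mul (k : ℝ)
  have e3 : Tendsto (fun n : ℕ => Real.exp (1 - x n) +
      Real.exp (2 * (k * (Real.log n / (n - 1)))) - 1) atTop (nhds 0) := by
    have h2 : Tendsto (fun n : ℕ => Real.exp (1 - x n)) atTop (nhds 0) :=
      Real.tendsto_exp_atBot.comp (tendsto_atBot_add_const_left _ 1 (tendsto_neg_atTop_atBot.comp hx))
    have h3 : Tendsto (fun n : ℕ => Real.exp (2 * (k * (Real.log n / (n - 1))))) atTop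
        (nhds (Real.exp (2 * 0))) :=
      (Real.continuous_exp.tendsto _).comp (e1.const_mul 2)
    simpa using (h2.add h3).sub_const 1
  refine squeeze_zero' (Eventually.of_forall fun i => prob_nonneg (h0 i) (h1 i) _) ?_ (e3.comp hN)
  filter_upwards [hp, hN.eventually_ge_atTop k, hN.eventually_ge_atTop 2,
    hN.eventually (hx.eventually_ge_atTop 0), hN.eventually (e1.eventually_le_const one_half_pos),
    hN.eventually (e2.eventually_le_const one_pos)] with i g1 g2 g3 g4 g5 g6
  exact motifProb_le hk hiso (h0 i) g2 g3 g4 g1 g5 g6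

end Main

section Above

open Classical

variable {k : ℕ} {H : SimpleGraph (Fin k)} {x : ℕ → ℝ}

lemma close_low_bound (hk : 0 < k) {n lam L : ℝ} (hn : n = Real.exp L) (hL : 16 ≤ L)
    (hlam : L ≤ lam) (hlam' : lam ≤ 2 * L) :
    (2 * (10 * k) : ℕ) * ((2 * lam) ^ (2 * (10 * k)) * Real.exp (2 * (10 * k) : ℕ) *
          Real.exp (1 - 2 * lam)) *
        (n * (1 + k * (⌈L ^ 2⌉₊ : ℝ)) ^ 4 +
          n ^ 2 * (n * (Real.exp 1 * lam / ⌈L ^ 2⌉₊) ^ ⌈L ^ 2⌉₊)) ≤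
      ((2 * (10 * k) : ℕ) * (4 ^ (2 * (10 * k)) * Real.exp (2 * (10 * k) : ℕ) * Real.exp 1) *
        (2 * (3 * k) ^ 4)) * (L ^ (2 * (10 * k) + 8) * Real.exp (-L)) := by
  have hk0 : (1 : ℝ) ≤ k := by exact_mod_cast hk
  have ht : L ^ 2 ≤ ⌈L ^ 2⌉₊ := Nat.le_ceil _
  have ht' : (⌈L ^ 2⌉₊ : ℝ) < L ^ 2 + 1 := Nat.ceil_lt_add_one (by positivity)
  set t := ⌈L ^ 2⌉₊
  have hL2 : 1 ≤ L ^ 2 := by nlinarith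
  have ht0 : (0 : ℝ) < t := by linarith
  have hn0 : 0 < n := hn ▸ Real.exp_pos L
  have hpow : n ^ 2 * (Real.exp 1 * lam / t) ^ t ≤ 1 := by
    have h1 : Real.exp 1 * lam / t ≤ Real.exp (-1) := by
      rw [div_le_iff₀ ht0, Real.exp_neg, ← div_eq_inv_mul, le_div_iff₀ (Real.exp_pos 1)]
      have he : Real.exp 1 < 2.7182818286 := Real.exp_one_lt_d9
      have he0 := Real.exp_pos 1
      have h2 : Real.exp 1 * Real.exp 1 ≤ 8 := by nlinarith
      calc Real.exp 1 * lam * Real.exp 1 = (Real.exp 1 * Real.exp 1) * lam := by ring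
        _ ≤ 8 * (2 * L) := by gcongr; linarith
        _ ≤ L ^ 2 := by nlinarith
        _ ≤ t := ht
    calc n ^ 2 * (Real.exp 1 * lam / t) ^ t ≤ n ^ 2 * (Real.exp (-1)) ^ t := by
          have : 0 ≤ lam := by linarith
          gcongr
      _ = Real.exp (2 * L - t) := by
          rw [hn, ← Real.exp_nat_mul, ← Real.exp_nat_mul, ← Real.exp_add]
          congr 1
          push_cast
          ring
      _ ≤ 1 := by
          rw [Real.exp_le_one_iff]
          nlinarith
  have hsecond : n * (1 + k * (t : ℝ)) ^ 4 + n ^ 2 * (n * (Real.exp 1 * lam / t) ^ t) ≤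
      n * (2 * (3 * k) ^ 4 * L ^ 8) := by
    have h1 : 1 + k * (t : ℝ) ≤ 3 * k * L ^ 2 := by nlinarith
    have h2 : (1 + k * (t : ℝ)) ^ 4 ≤ (3 * k * L ^ 2) ^ 4 := by gcongr
    have h3 : (1 : ℝ) ≤ (3 * k * L ^ 2) ^ 4 := one_le_pow₀ (by nlinarith)
    calc _ = n * ((1 + k * (t : ℝ)) ^ 4 + n ^ 2 * (Real.exp 1 * lam / t) ^ t) := by ring
      _ ≤ n * ((3 * k * L ^ 2) ^ 4 + (3 * k * L ^ 2) ^ 4) := by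
          gcongr
          linarith
      _ = _ := by ring
  calc _ ≤ (2 * (10 * k) : ℕ) * ((4 * L) ^ (2 * (10 * k)) * Real.exp (2 * (10 * k) : ℕ) *
          Real.exp (1 - 2 * L)) * (n * (2 * (3 * k) ^ 4 * L ^ 8)) := by
        have h4 : 2 * lam ≤ 4 * L := by linarith
        have h5 : 0 ≤ lam := by linarith
        gcongr
    _ = _ := by
        rw [hn, sub_eq_add_neg, Real.exp_add 1, pow_add L,
          show -(2 * L) = -L + -L by ring, Real.exp_add (-L), Real.exp_neg L, mul_pow]
        field_simp

variable (k x) in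
/-- An explicit bound for the probability of having no perfect matching. -/
noncomputable def failureBound (n : ℕ) : ℝ :=
  Real.exp (-x n) +
    ((2 * (10 * k) : ℕ) * (4 ^ (2 * (10 * k)) * Real.exp (2 * (10 * k) : ℕ) * Real.exp 1) *
        (2 * (3 * k) ^ 4)) *
      (Real.log n ^ (2 * (10 * k) + 8) * Real.exp (-Real.log n)) +
    2 * (20 * Real.exp 1 ^ 3 * k ^ 2 * (Real.log n)⁻¹) +
    2 * (Real.exp 1 ^ 2 * (Real.log n ^ 6 * Real.exp (-(Real.log n / (2 * k ^ 2))))) +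
    (1 / 2) ^ n

lemma tendsto_pow_mul_exp_neg_div (j : ℕ) {c : ℝ} (hc : 0 < c) :
    Tendsto (fun n : ℕ => Real.log n ^ j * Real.exp (-(Real.log n / c))) atTop (nhds 0) := by
  have h := ((Real.tendsto_pow_mul_exp_neg_atTop_nhds_zero j).comp
    (tendsto_log_nat.atTop_div_const hc)).const_mul (c ^ j)
  rw [mul_zero] at h
  refine h.congr fun n => ?_
  simp only [Function.comp, div_pow]
  field_simp

lemma tendsto_inv_log (C : ℝ) : Tendsto (fun n : ℕ => C * (Real.log n)⁻¹) atTop (nhds 0) := by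
  simpa using (tendsto_inv_atTop_zero.comp tendsto_log_nat).const_mul C

lemma tendsto_failureBound (hk : 0 < k) (hx : Tendsto x atTop atTop) :
    Tendsto (failureBound k x) atTop (nhds 0) := by
  have hk0 : (0 : ℝ) < k := by exact_mod_cast hk
  have h1 : Tendsto (fun n : ℕ => Real.exp (-x n)) atTop (nhds 0) :=
    Real.tendsto_exp_atBot.comp (tendsto_neg_atTop_atBot.comp hx)
  have h2 := ((Real.tendsto_pow_mul_exp_neg_atTop_nhds_zero (2 * (10 * k) + 8)).comp
    tendsto_log_nat).const_mul ((2 * (10 * k) : ℕ) * (4 ^ (2 * (10 * k)) *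
      Real.exp (2 * (10 * k) : ℕ) * Real.exp 1) * (2 * (3 * k) ^ 4))
  have h3 := (tendsto_inv_log (20 * Real.exp 1 ^ 3 * k ^ 2)).const_mul 2
  have h4 := ((tendsto_pow_mul_exp_neg_div 6 (c := 2 * k ^ 2) (by positivity)).const_mul
    (Real.exp 1 ^ 2)).const_mul 2
  have h5 := tendsto_pow_atTop_nhds_zero_of_lt_one (r := (1 / 2 : ℝ)) (by norm_num) (by norm_num)
  have h := (((h1.add h2).add h3).add h4).add h5
  simp only [mul_zero, add_zero] at h
  exact h

/-- Above the threshold. -/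
lemma le_motifProb {n : ℕ} (hk : 0 < k) (hiso : ∀ v, (H.neighborSet v).Nonempty) {p : ℝ}
    (h1 : p ≤ 1) (hkn : k ≤ n) (heven : Even n) (hx : 0 ≤ x n) (hx' : x n ≤ Real.log n)
    (hp : pPlus H 1 x n ≤ p) (hL : 16 ≤ Real.log n)
    (hsmall : k * (Real.log n / (n - 1)) ≤ 1 / 2)
    (hr : 20 * Real.exp 1 ^ 3 * k ^ 2 * (Real.log n)⁻¹ ≤ 1 / 2)
    (hr' : Real.exp 1 ^ 2 * (Real.log n ^ 6 * Real.exp (-(Real.log n / (2 * k ^ 2)))) ≤ 1 / 2)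
    (hlarge : Real.exp (-(Real.log n / (64 * k ^ 2))) ≤ 1 / 8) :
    1 - failureBound k x n ≤
      motifProb H n p (fun G => ∃ M : G.Subgraph, M.IsPerfectMatching) := by
  have hn : 2 ≤ n := by
    by_contra! h
    have : n = 0 ∨ n = 1 := by omega
    rcases this with rfl | rfl <;> norm_num at hL
  have hn0 : (2 : ℝ) ≤ n := by exact_mod_cast hn
  have hk0 : (0 : ℝ) < k := by exact_mod_cast hk
  have hN := mr_pos (H := H) hk hiso hkn hn
  set L := Real.log n with hLdef
  set q := pPlus H 1 x n with hq
  have hnL : (n : ℝ) = Real.exp L := (Real.exp_log (by linarith)).symm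
  have hlam : mr H n 1 * q = L + x n := by
    rw [hq, pPlus_eq hk hiso]
    field_simp
    ring
  have hq0 : 0 ≤ q := by
    rw [hq, pPlus_eq hk hiso]
    have : 0 ≤ Real.log n + x n := by linarith
    positivity
  have hq1 : q ≤ 1 := hp.trans h1
  have hmono : prob q (fun ω : Copy H n → Bool => ∃ M : (graphOf ω).Subgraph, M.IsPerfectMatching) ≤
      prob p (fun ω : Copy H n → Bool => ∃ M : (graphOf ω).Subgraph, M.IsPerfectMatching) :=
    prob_mono_param hq0 hp h1 fun a b hab h => isPerfectMatching_mono (graphOf_mono hab) h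
  refine le_trans ?_ hmono
  have e1 := prob_not q (fun ω : Copy H n → Bool =>
    ∃ M : (graphOf ω).Subgraph, M.IsPerfectMatching)
  have hsmall' : (L + x n) * k ≤ n - 1 := by
    rw [← mul_div_assoc, div_le_iff₀ (by linarith)] at hsmall
    nlinarith
  have b3 : Real.exp 1 ^ 3 * k ^ 2 * (L + x n) ^ 2 * (5 * (n / L ^ 3)) / n ≤
      20 * Real.exp 1 ^ 3 * k ^ 2 * L⁻¹ := by
    calc _ ≤ Real.exp 1 ^ 3 * k ^ 2 * (2 * L) ^ 2 * (5 * (n / L ^ 3)) / n := by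
          gcongr
          linarith
      _ = _ := by
          field_simp
          ring
  have b4 : (Real.exp 1 * n / (n / L ^ 3)) ^ 2 * Real.exp (-((L + x n) / (2 * k ^ 2))) ≤
      Real.exp 1 ^ 2 * (L ^ 6 * Real.exp (-(L / (2 * k ^ 2)))) := by
    calc _ = Real.exp 1 ^ 2 * (L ^ 6 * Real.exp (-((L + x n) / (2 * k ^ 2)))) := by
          field_simp
      _ ≤ _ := by
          gcongr
          linarith
  have b5 : 4 ^ n * Real.exp (-(n * (L + x n) / (64 * k ^ 2))) ≤ (1 / 2) ^ n := by
    calc _ ≤ 4 ^ n * Real.exp (-(L / (64 * k ^ 2))) ^ n := by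
          rw [← Real.exp_nat_mul]
          gcongr
          rw [mul_neg, neg_le_neg_iff, ← mul_div_assoc]
          gcongr
          linarith
      _ ≤ 4 ^ n * (1 / 8) ^ n := by gcongr
      _ = _ := by
          rw [← mul_pow]
          norm_num
  have b1 : n * Real.exp (-(L + x n)) = Real.exp (-x n) := by
    rw [hnL, ← Real.exp_add]
    congr 1
    ring
  have b2 := close_low_bound (k := k) hk hnL hL (lam := L + x n) (by linarith) (by linarith)
  have key := prob_not_perfect_matching_le (H := H) hiso hk hq0 hq1 hlam hn heven hsmall'
    (by linarith) ⌈L ^ 2⌉₊ (θ := n / L ^ 3) (by positivity) (b3.trans hr) (b4.trans hr')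
  rw [e1, b1] at key
  unfold failureBound
  linarith

lemma tendsto_motifProb_one (hk : 0 < k) (hiso : ∀ v, (H.neighborSet v).Nonempty)
    (hx : Tendsto x atTop atTop)
    (hx' : Tendsto (fun n => x n / Real.log (Real.log n)) atTop (nhds 0))
    {ι : Type*} {l : Filter ι} {N : ι → ℕ} (hN : Tendsto N l atTop) (heven : ∀ i, Even (N i))
    {p : ι → ℝ} (h0 : ∀ i, 0 ≤ p i) (h1 : ∀ i, p i ≤ 1)
    (hp : ∀ᶠ i in l, pPlus H 1 x (N i) ≤ p i) :
    Tendsto (fun i => motifProb H (N i) (p i)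
      (fun G => ∃ M : G.Subgraph, M.IsPerfectMatching)) l (nhds 1) := by
  have hk0 : (0 : ℝ) < k := by exact_mod_cast hk
  have e1 : Tendsto (fun n : ℕ => k * (Real.log n / (n - 1))) atTop (nhds 0) := by
    simpa using (tendsto_log_pow_div 1).const_mul (k : ℝ)
  have e2 := tendsto_inv_log (20 * Real.exp 1 ^ 3 * k ^ 2)
  have e3 := (tendsto_pow_mul_exp_neg_div 6 (c := 2 * k ^ 2) (by positivity)).const_mul
    (Real.exp 1 ^ 2)
  rw [mul_zero] at e3
  have e4 := tendsto_pow_mul_exp_neg_div 0 (c := 64 * k ^ 2) (by positivity)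
  simp only [pow_zero, one_mul] at e4
  have hlim : Tendsto (fun i => 1 - failureBound k x (N i)) l (nhds 1) := by
    simpa using ((tendsto_failureBound hk hx).comp hN).const_sub 1
  refine tendsto_of_tendsto_of_tendsto_of_le_of_le' hlim tendsto_const_nhds ?_
    (Eventually.of_forall fun i => prob_le_one (h0 i) (h1 i) _)
  filter_upwards [hp, hN.eventually_ge_atTop k, hN.eventually (eventually_bounds hx hx'),
    hN.eventually (tendsto_log_nat.eventually_ge_atTop 16),
    hN.eventually (e1.eventually_le_const one_half_pos),
    hN.eventually (e2.eventually_le_const one_half_pos),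
    hN.eventually (e3.eventually_le_const one_half_pos),
    hN.eventually (e4.eventually_le_const (by norm_num : (0 : ℝ) < 1 / 8))]
    with i g1 g2 g3 g4 g5 g6 g7 g8
  exact le_motifProb hk hiso (h1 i) g2 (heven i) g3.1 g3.2 g1 g4 g5 g6 g7 g8

end Above

/-- **Theorem 4 (perfect matching threshold).**  For even `n` (we let `n = 2m` and
take limits as `m → ∞`): if `p ≤ p_1^-(H)` then w.h.p. `G(H,n,p)` has no perfect
matching, and if `p ≥ p_1^+(H)` then w.h.p. it has one. -/
theorem perfect_matching_threshold {k : ℕ} (H : SimpleGraph (Fin k)) (hk : 0 < k)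
    (hiso : ∀ v, (H.neighborSet v).Nonempty)
    (x : ℕ → ℝ) (hx : Tendsto x atTop atTop)
    (hx' : Tendsto (fun n => x n / Real.log (Real.log n)) atTop (nhds 0))
    (p : ℕ → ℝ) (hp : ∀ n, 0 ≤ p n ∧ p n ≤ 1) :
    ((∀ᶠ m in atTop, p (2 * m) ≤ pMinus H 1 x (2 * m)) →
      Tendsto (fun m => motifProb H (2 * m) (p (2 * m))
        (fun G => ∃ M : G.Subgraph, M.IsPerfectMatching)) atTop (nhds 0)) ∧
    ((∀ᶠ m in atTop, pPlus H 1 x (2 * m) ≤ p (2 * m)) →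
      Tendsto (fun m => motifProb H (2 * m) (p (2 * m))
        (fun G => ∃ M : G.Subgraph, M.IsPerfectMatching)) atTop (nhds 1)) := by
  have hN : Tendsto (fun m : ℕ => 2 * m) atTop atTop :=
    tendsto_id.const_mul_atTop' two_pos
  exact ⟨fun h => tendsto_motifProb_zero hk hiso hx hN (fun m => (hp _).1) (fun m => (hp _).2) h,
    fun h => tendsto_motifProb_one hk hiso hx hx' hN (fun m => even_two_mul m)
      (fun m => (hp _).1) (fun m => (hp _).2) h⟩

end RandomMotif
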